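/- Let 0 < τ < max_E φ − min_E φ, and let ψ : ℂ → ℝ be a continuous periodic function with φ − τ ≤ ψ ≤ φ everywhere, which is distributionally superharmonic on the open periodic set {z : ψ(z) < φ(z)} (an 'upper bound weight'). Assume that the contact set M₊(ψ) = {z : ψ(z) = φ(z)} is contained in M₊ = {z : Δφ(z) > 0} and that M₊(ψ) has non-empty interior. Then limsup_{h→0⁺} 2πh·N(e^{−τ/h}, h) ≤ ∫_{M₊(ψ)∩E} Δφ(z) L(dz); equivalently, the number N([0,e^{−τ/h}]) of singular values of h∂̄ on L²_φ(M) in [0,e^{−τ/h}] satisfies N([0,e^{−τ/h}]) ≤ (1/(2πh))∫_{M₊(ψ)∩E} Δφ L(dz) + o(1)/h as h → 0⁺. -/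

import Mathlib

open MeasureTheory Real Complex

noncomputable section

/-- `f : ℂ → α` is 2π-periodic in both the real and the imaginary direction. -/
def PeriodicC {α : Type*} (f : ℂ → α) : Prop :=
  ∀ z : ℂ, f (z + (2 * Real.pi : ℝ)) = f z ∧ f (z + (2 * Real.pi : ℝ) * Complex.I) = f z

/-- The Cauchy–Riemann operator `∂̄ = (∂ₓ + i ∂_y)/2`. -/
noncomputable def dbar (u : ℂ → ℂ) (z : ℂ) : ℂ :=
  (fderiv ℝ u z 1 + Complex.I * fderiv ℝ u z Complex.I) / 2

/-- The Laplacian `Δ = ∂ₓ² + ∂_y²` of a real-valued function on `ℂ ≅ ℝ²`. -/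
noncomputable def lapC (f : ℂ → ℝ) (z : ℂ) : ℝ :=
  fderiv ℝ (fun w => fderiv ℝ f w 1) z 1 +
    fderiv ℝ (fun w => fderiv ℝ f w Complex.I) z Complex.I

/-- The fundamental domain `E = [0,2π) × [0,2π)`. -/
def Efd : Set ℂ :=
  {z : ℂ | z.re ∈ Set.Ico 0 (2 * Real.pi) ∧ z.im ∈ Set.Ico 0 (2 * Real.pi)}

/-- The squared weighted norm `‖u‖_{φ,h}² = ∫_E |u|² e^{-2φ/h}`. -/
noncomputable def wInt (φ : ℂ → ℝ) (h : ℝ) (u : ℂ → ℂ) : ℝ :=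
  ∫ z in Efd, ‖u z‖ ^ 2 * Real.exp (-2 * φ z / h)

/-- The counting function `N(t,h)`: the supremum of `dim V` over finite-dimensional
complex subspaces `V` of smooth periodic functions on which `‖h ∂̄ u‖_{φ,h} ≤ t ‖u‖_{φ,h}`. -/
noncomputable def countN (φ : ℂ → ℝ) (t h : ℝ) : ℕ :=
  sSup {n : ℕ | ∃ V : Submodule ℂ (ℂ → ℂ),
    Module.finrank ℂ V = n ∧
    (∀ u ∈ V, ContDiff ℝ (⊤ : ℕ∞) u ∧ PeriodicC u) ∧
    (∀ u ∈ V, wInt φ h (fun z => (h : ℂ) * dbar u z) ≤ t ^ 2 * wInt φ h u)}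

/-- `v` is distributionally subharmonic on the open set `U`. -/
def DSubhOn (v : ℂ → ℝ) (U : Set ℂ) : Prop :=
  ∀ χ : ℂ → ℝ, ContDiff ℝ (⊤ : ℕ∞) χ → HasCompactSupport χ → (∀ z, 0 ≤ χ z) →
    tsupport χ ⊆ U → 0 ≤ ∫ z : ℂ, v z * lapC χ z

/-- `v` is distributionally superharmonic on the open set `U`. -/
def DSuphOn (v : ℂ → ℝ) (U : Set ℂ) : Prop :=
  ∀ χ : ℂ → ℝ, ContDiff ℝ (⊤ : ℕ∞) χ → HasCompactSupport χ → (∀ z, 0 ≤ χ z) →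
    tsupport χ ⊆ U → (∫ z : ℂ, v z * lapC χ z) ≤ 0

lemma PeriodicC.add_lattice {α : Type*} {f : ℂ → α} (hf : PeriodicC f) (m n : ℤ) (z : ℂ) :
    f (z + ((m * (2 * Real.pi) : ℝ) + (n * (2 * Real.pi) : ℝ) * Complex.I)) = f z := by
  have h1 : Function.Periodic f ((2 * Real.pi : ℝ) : ℂ) := fun z => (hf z).1
  have h2 : Function.Periodic f (((2 * Real.pi : ℝ) : ℂ) * Complex.I) := fun z => (hf z).2
  have := (h2.int_mul n) (z + (m : ℂ) * ((2 * Real.pi : ℝ) : ℂ))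
  rw [h1.int_mul m z] at this
  rw [← this]
  congr 1
  push_cast
  ring

lemma exists_lattice_add_mem_Efd (z : ℂ) :
    ∃ m n : ℤ, z + ((m * (2 * Real.pi) : ℝ) + (n * (2 * Real.pi) : ℝ) * Complex.I) ∈ Efd := by
  obtain ⟨m, hm, -⟩ := existsUnique_add_zsmul_mem_Ico Real.two_pi_pos z.re 0
  obtain ⟨n, hn, -⟩ := existsUnique_add_zsmul_mem_Ico Real.two_pi_pos z.im 0
  refine ⟨m, n, ?_, ?_⟩
  · simpa using hm
  · simpa using hn

lemma PeriodicC.comp {α β : Type*} {f : ℂ → α} (hf : PeriodicC f) (g : α → β) :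
    PeriodicC (fun z => g (f z)) := fun z => ⟨congrArg g (hf z).1, congrArg g (hf z).2⟩

lemma PeriodicC.comp_two {α β γ : Type*} {f : ℂ → α} {g : ℂ → β} (hf : PeriodicC f)
    (hg : PeriodicC g) (k : α → β → γ) : PeriodicC (fun z => k (f z) (g z)) :=
  fun z => ⟨by simp only [(hf z).1, (hg z).1], by simp only [(hf z).2, (hg z).2]⟩

lemma PeriodicC.fderiv {F : Type*} [NormedAddCommGroup F] [NormedSpace ℝ F] {f : ℂ → F}
    (hf : PeriodicC f) : PeriodicC (fun z => fderiv ℝ f z) := by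
  intro z
  constructor
  · dsimp only
    rw [← fderiv_comp_add_right]
    exact congrArg (fun k => _root_.fderiv ℝ k z) (funext fun w => (hf w).1)
  · dsimp only
    rw [← fderiv_comp_add_right]
    exact congrArg (fun k => _root_.fderiv ℝ k z) (funext fun w => (hf w).2)

lemma PeriodicC.dbar {u : ℂ → ℂ} (hu : PeriodicC u) : PeriodicC (dbar u) :=
  hu.fderiv.comp (fun L : ℂ →L[ℝ] ℂ => (L 1 + Complex.I * L Complex.I) / 2)

lemma PeriodicC.lapC {f : ℂ → ℝ} (hf : PeriodicC f) : PeriodicC (lapC f) := by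
  have h1 := (hf.fderiv.comp (fun L : ℂ →L[ℝ] ℝ => L 1)).fderiv
  have h2 := (hf.fderiv.comp (fun L : ℂ →L[ℝ] ℝ => L Complex.I)).fderiv
  exact h1.comp_two h2 (fun L M => L 1 + M Complex.I)

lemma Efd_eq_preimage_prod :
    Efd = Complex.measurableEquivRealProd ⁻¹'
      (Set.Ico 0 (2 * Real.pi) ×ˢ Set.Ico 0 (2 * Real.pi)) := rfl

lemma measurableSet_Efd : MeasurableSet Efd := by
  rw [Efd_eq_preimage_prod]
  exact Complex.measurableEquivRealProd.measurable (measurableSet_Ico.prod measurableSet_Ico)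

lemma volume_Efd_lt_top : volume Efd < ⊤ := by
  rw [Efd_eq_preimage_prod, Complex.volume_preserving_equiv_real_prod.measure_preimage
    (measurableSet_Ico.prod measurableSet_Ico).nullMeasurableSet, Measure.volume_eq_prod,
    Measure.prod_prod, Real.volume_Ico]
  exact ENNReal.mul_lt_top ENNReal.ofReal_lt_top ENNReal.ofReal_lt_top

instance isFiniteMeasure_restrict_Efd : IsFiniteMeasure (volume.restrict Efd) :=
  ⟨by simpa using volume_Efd_lt_top⟩

lemma measureReal_Efd : volume.real Efd = 4 * Real.pi ^ 2 := by
  rw [Measure.real, Efd_eq_preimage_prod,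
    Complex.volume_preserving_equiv_real_prod.measure_preimage
    (measurableSet_Ico.prod measurableSet_Ico).nullMeasurableSet, Measure.volume_eq_prod,
    Measure.prod_prod, Real.volume_Ico, ENNReal.toReal_mul,
    ENNReal.toReal_ofReal (by linarith [Real.pi_pos])]
  ring

/-- The compact box of points at sup-distance at most one from the closure of `Efd`. -/
lemma isCompact_reProdIm_box :
    IsCompact (Set.Icc (-1) (2 * Real.pi + 1) ×ℂ Set.Icc (-1) (2 * Real.pi + 1)) :=
  isCompact_Icc.reProdIm isCompact_Icc

lemma PeriodicC.uniformContinuous {F : Type*} [PseudoMetricSpace F] {f : ℂ → F}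
    (hf : PeriodicC f) (hc : Continuous f) : UniformContinuous f := by
  have hu := isCompact_reProdIm_box.uniformContinuousOn_of_continuous hc.continuousOn
  rw [Metric.uniformContinuousOn_iff] at hu
  rw [Metric.uniformContinuous_iff]
  intro ε hε
  obtain ⟨δ, hδ, h⟩ := hu ε hε
  refine ⟨min δ 1, by positivity, fun {a b} hab => ?_⟩
  obtain ⟨m, n, hmn⟩ := exists_lattice_add_mem_Efd a
  set l : ℂ := ((m * (2 * Real.pi) : ℝ) + (n * (2 * Real.pi) : ℝ) * Complex.I) with hl
  rw [← hf.add_lattice m n a, ← hf.add_lattice m n b, ← hl]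
  have hd : dist (a + l) (b + l) < min δ 1 := by simpa using hab
  obtain ⟨⟨h1, h2⟩, ⟨h3, h4⟩⟩ := hmn
  have hre : |(a + l).re - (b + l).re| < 1 := by
    rw [← Complex.sub_re]
    exact (Complex.abs_re_le_norm _).trans_lt
      (by rw [← dist_eq_norm]; exact hd.trans_le (min_le_right _ _))
  have him : |(a + l).im - (b + l).im| < 1 := by
    rw [← Complex.sub_im]
    exact (Complex.abs_im_le_norm _).trans_lt
      (by rw [← dist_eq_norm]; exact hd.trans_le (min_le_right _ _))
  rw [abs_lt] at hre him
  refine h _ ?_ _ ?_ (hd.trans_le (min_le_left _ _))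
  · exact ⟨⟨by linarith, by linarith⟩, ⟨by linarith, by linarith⟩⟩
  · exact ⟨⟨by linarith, by linarith⟩, ⟨by linarith, by linarith⟩⟩

lemma PeriodicC.exists_norm_le {F : Type*} [SeminormedAddCommGroup F] {f : ℂ → F}
    (hf : PeriodicC f) (hc : Continuous f) : ∃ C, 0 ≤ C ∧ ∀ z, ‖f z‖ ≤ C := by
  obtain ⟨C, hC⟩ := isCompact_reProdIm_box.exists_bound_of_continuousOn hc.continuousOn
  have key : ∀ z, ‖f z‖ ≤ C := by
    intro z
    obtain ⟨m, n, hmn⟩ := exists_lattice_add_mem_Efd z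
    rw [← hf.add_lattice m n z]
    obtain ⟨⟨h1, h2⟩, ⟨h3, h4⟩⟩ := hmn
    exact hC _ ⟨⟨by linarith, by linarith⟩, ⟨by linarith, by linarith⟩⟩
  exact ⟨C, (norm_nonneg _).trans (key 0), key⟩

lemma Continuous.integrableOn_Efd {F : Type*} [NormedAddCommGroup F] {f : ℂ → F}
    (hc : Continuous f) : IntegrableOn f Efd := by
  refine (hc.continuousOn.integrableOn_compact isCompact_reProdIm_box).mono_set ?_
  rintro z ⟨⟨h1, h2⟩, ⟨h3, h4⟩⟩
  exact ⟨⟨by linarith, by linarith⟩, ⟨by linarith, by linarith⟩⟩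

lemma setIntegral_Efd_eq_intervalIntegral {f : ℂ → ℝ} (hc : Continuous f) :
    ∫ z in Efd, f z =
      ∫ x in (0 : ℝ)..2 * Real.pi, ∫ y in (0 : ℝ)..2 * Real.pi, f (x + y * Complex.I) := by
  have hpi := Real.two_pi_pos.le
  have h1 : ∫ z in Efd, f z = ∫ p in Set.Ico 0 (2 * Real.pi) ×ˢ Set.Ico 0 (2 * Real.pi),
      f (p.1 + p.2 * Complex.I) := by
    rw [Efd_eq_preimage_prod, ← Complex.volume_preserving_equiv_real_prod.setIntegral_preimage_emb
      Complex.measurableEquivRealProd.measurableEmbedding]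
    refine setIntegral_congr_fun (measurableSet_Efd) fun z _ => ?_
    simp
  have hint : IntegrableOn (fun p : ℝ × ℝ => f (p.1 + p.2 * Complex.I))
      (Set.Ico 0 (2 * Real.pi) ×ˢ Set.Ico 0 (2 * Real.pi)) := by
    refine IntegrableOn.mono_set (t := Set.Icc 0 (2 * Real.pi) ×ˢ Set.Icc 0 (2 * Real.pi)) ?_
      (Set.prod_mono Set.Ico_subset_Icc_self Set.Ico_subset_Icc_self)
    refine ContinuousOn.integrableOn_compact (isCompact_Icc.prod isCompact_Icc) ?_
    fun_prop
  rw [h1, Measure.volume_eq_prod, setIntegral_prod _ hint, integral_Ico_eq_integral_Ioc,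
    intervalIntegral.integral_of_le hpi]
  refine setIntegral_congr_fun measurableSet_Ioc fun x _ => ?_
  simp only
  rw [integral_Ico_eq_integral_Ioc, intervalIntegral.integral_of_le hpi]

lemma PeriodicC.setIntegral_Efd_comp_add {f : ℂ → ℝ} (hf : PeriodicC f) (hc : Continuous f)
    (c : ℂ) : ∫ z in Efd, f (z + c) = ∫ z in Efd, f z := by
  rw [setIntegral_Efd_eq_intervalIntegral hc,
    setIntegral_Efd_eq_intervalIntegral (f := fun z => f (z + c)) (by fun_prop)]
  have hinner : ∀ x : ℝ, ∫ y in (0 : ℝ)..2 * Real.pi, f (x + y * Complex.I + c) =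
      ∫ y in (0 : ℝ)..2 * Real.pi, f ((x + c.re : ℝ) + y * Complex.I) := by
    intro x
    have hp : Function.Periodic (fun y : ℝ => f ((x + c.re : ℝ) + y * Complex.I))
        (2 * Real.pi) := by
      intro y
      dsimp only
      rw [← (hf ((x + c.re : ℝ) + y * Complex.I)).2]
      congr 1
      push_cast
      ring
    have h2 := hp.intervalIntegral_add_eq c.im 0
    rw [zero_add] at h2
    rw [← h2, add_comm c.im, ← zero_add c.im, ← add_assoc, add_zero,
      ← intervalIntegral.integral_comp_add_right]
    refine intervalIntegral.integral_congr fun y _ => ?_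
    congr 1
    conv_lhs => rw [← Complex.re_add_im c]
    push_cast
    ring
  simp_rw [hinner]
  have hp : Function.Periodic
      (fun x : ℝ => ∫ y in (0 : ℝ)..2 * Real.pi, f (x + y * Complex.I)) (2 * Real.pi) := by
    intro x
    refine intervalIntegral.integral_congr fun y _ => ?_
    rw [← (hf (x + y * Complex.I)).1]
    congr 1
    push_cast
    ring
  have h2 := hp.intervalIntegral_add_eq c.re 0
  rw [zero_add] at h2
  rw [← h2, intervalIntegral.integral_comp_add_right
    (fun x : ℝ => ∫ y in (0 : ℝ)..2 * Real.pi, f (x + y * Complex.I))]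
  simp [add_comm]

lemma PeriodicC.setIntegral_ball_le {f : ℂ → ℝ} (hf : PeriodicC f) (hc : Continuous f)
    (h0 : ∀ z, 0 ≤ f z) (z : ℂ) {r : ℝ} (hr : r ≤ Real.pi) :
    ∫ w in Metric.ball 0 r, f (z + w) ≤ ∫ w in Efd, f w := by
  set c : ℂ := Real.pi + Real.pi * Complex.I with hcdef
  have hsub : Metric.ball (0 : ℂ) r ⊆ (fun w => w + c) ⁻¹' Efd := by
    intro w hw
    rw [mem_ball_zero_iff] at hw
    have h1 := abs_lt.1 ((Complex.abs_re_le_norm w).trans_lt (hw.trans_le hr))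
    have h2 := abs_lt.1 ((Complex.abs_im_le_norm w).trans_lt (hw.trans_le hr))
    constructor
    · simp [hcdef]; constructor <;> linarith
    · simp [hcdef]; constructor <;> linarith
  have hmp := measurePreserving_add_right (volume : Measure ℂ) c
  have hemb : MeasurableEmbedding (fun w : ℂ => w + c) := measurableEmbedding_addRight c
  have hcont : Continuous fun w => f (w + (z - c)) := by fun_prop
  have hpre := hmp.setIntegral_preimage_emb hemb (fun w => f (w + (z - c))) Efd
  have hintegr := (hmp.integrableOn_comp_preimage hemb (s := Efd)
    (f := fun w => f (w + (z - c)))).2 hcont.integrableOn_Efd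
  rw [← hf.setIntegral_Efd_comp_add hc (z - c), ← hpre]
  have heq : ∀ w, f (z + w) = f (w + c + (z - c)) := fun w => by congr 1; ring
  simp_rw [heq]
  exact setIntegral_mono_set hintegr (Filter.Eventually.of_forall fun w => h0 _)
    hsub.eventuallyLE

lemma setIntegral_ball_eq_polar {F : Type*} [NormedAddCommGroup F] [NormedSpace ℝ F]
    {k : ℂ → F} (hk : Continuous k) {r : ℝ} (hr : 0 ≤ r) :
    ∫ w in Metric.ball 0 r, k w =
      ∫ s in (0 : ℝ)..r, ∫ θ in (-Real.pi)..Real.pi, s • k (s * Complex.exp (θ * Complex.I)) := by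
  have hpi : -Real.pi ≤ Real.pi := by linarith [Real.pi_pos]
  have hcont : Continuous fun p : ℝ × ℝ => p.1 • k (p.1 * Complex.exp (p.2 * Complex.I)) := by
    fun_prop
  rw [← integral_indicator Metric.isOpen_ball.measurableSet,
    ← Complex.integral_comp_polarCoord_symm, polarCoord_target]
  have h1 : ∫ p in Set.Ioi (0 : ℝ) ×ˢ Set.Ioo (-Real.pi) Real.pi,
      p.1 • (Metric.ball 0 r).indicator k (Complex.polarCoord.symm p) =
      ∫ p in Set.Ioi (0 : ℝ) ×ˢ Set.Ioo (-Real.pi) Real.pi,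
        (Set.Iio r ×ˢ Set.univ).indicator
          (fun p : ℝ × ℝ => p.1 • k (p.1 * Complex.exp (p.2 * Complex.I))) p := by
    refine setIntegral_congr_fun (measurableSet_Ioi.prod measurableSet_Ioo) ?_
    rintro ⟨s, θ⟩ ⟨hs, -⟩
    have hs : 0 < s := hs
    have he : Complex.polarCoord.symm (s, θ) = s * Complex.exp (θ * Complex.I) := by
      rw [Complex.polarCoord_symm_apply, Complex.exp_mul_I]
      push_cast
      rfl
    dsimp only
    by_cases hsr : s < r
    · rw [Set.indicator_of_mem (show (s, θ) ∈ Set.Iio r ×ˢ Set.univ from ⟨hsr, trivial⟩),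
        Set.indicator_of_mem, he]
      rw [mem_ball_zero_iff, Complex.norm_polarCoord_symm, abs_of_pos hs]
      exact hsr
    · rw [Set.indicator_of_notMem (fun h : (s, θ) ∈ Set.Iio r ×ˢ Set.univ => hsr h.1),
        Set.indicator_of_notMem, smul_zero]
      rw [mem_ball_zero_iff, Complex.norm_polarCoord_symm, abs_of_pos hs]
      exact hsr
  rw [h1, setIntegral_indicator (measurableSet_Iio.prod MeasurableSet.univ), Set.prod_inter_prod,
    Set.inter_univ, Set.Ioi_inter_Iio, Measure.volume_eq_prod, setIntegral_prod,
    ← integral_Ioc_eq_integral_Ioo, intervalIntegral.integral_of_le hr]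
  · refine setIntegral_congr_fun measurableSet_Ioc fun s _ => ?_
    simp only
    rw [← integral_Ioc_eq_integral_Ioo, intervalIntegral.integral_of_le hpi]
  · refine IntegrableOn.mono_set (t := Set.Icc 0 r ×ˢ Set.Icc (-Real.pi) Real.pi) ?_
      (Set.prod_mono Set.Ioo_subset_Icc_self Set.Ioo_subset_Icc_self)
    exact hcont.continuousOn.integrableOn_compact (isCompact_Icc.prod isCompact_Icc)

lemma integrable_prod_Ioc_of_continuous {F : Type*} [NormedAddCommGroup F]
    {f : ℝ × ℝ → F} (hf : Continuous f) (a b c d : ℝ) :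
    Integrable f ((volume.restrict (Set.Ioc a b)).prod (volume.restrict (Set.Ioc c d))) := by
  rw [Measure.prod_restrict, ← Measure.volume_eq_prod]
  refine IntegrableOn.mono_set (t := Set.Icc a b ×ˢ Set.Icc c d) ?_
    (Set.prod_mono Set.Ioc_subset_Icc_self Set.Ioc_subset_Icc_self)
  exact hf.continuousOn.integrableOn_compact (isCompact_Icc.prod isCompact_Icc)

lemma intervalIntegral_swap_of_continuous {F : Type*} [NormedAddCommGroup F] [NormedSpace ℝ F]
    {f : ℝ → ℝ → F} (hf : Continuous (Function.uncurry f)) {a b c d : ℝ} (hab : a ≤ b)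
    (hcd : c ≤ d) :
    ∫ x in a..b, ∫ y in c..d, f x y = ∫ y in c..d, ∫ x in a..b, f x y := by
  simp_rw [intervalIntegral.integral_of_le hab, intervalIntegral.integral_of_le hcd]
  exact integral_integral_swap (integrable_prod_Ioc_of_continuous hf a b c d)

lemma apply_exp_mul_I_eq_dbar (L : ℂ →L[ℝ] ℂ) (θ : ℝ) :
    L (Complex.exp (θ * Complex.I)) =
      2 * Complex.exp (-(θ * Complex.I)) * ((L 1 + Complex.I * L Complex.I) / 2)
        - Complex.I * L (Complex.I * Complex.exp (θ * Complex.I)) := by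
  have e1 : Complex.exp (θ * Complex.I) =
      (Real.cos θ) • (1 : ℂ) + (Real.sin θ) • Complex.I := by
    rw [Complex.exp_mul_I]; simp
  have e2 : Complex.I * Complex.exp (θ * Complex.I) =
      (-Real.sin θ) • (1 : ℂ) + (Real.cos θ) • Complex.I := by
    rw [Complex.exp_mul_I]; simp; ring_nf; simp; ring
  have e3 : Complex.exp (-(θ * Complex.I)) = Real.cos θ - Real.sin θ * Complex.I := by
    rw [← neg_mul, Complex.exp_mul_I, Complex.cos_neg, Complex.sin_neg]; simp; ring
  rw [e2, e1, e3]
  simp only [map_add, map_smul]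
  simp only [Complex.real_smul]
  push_cast
  linear_combination (Complex.sin θ * L Complex.I) * Complex.I_sq

lemma hasDerivAt_comp_radius {U : ℂ → ℂ} (hU : ContDiff ℝ 1 U) (θ s : ℝ) :
    HasDerivAt (fun s : ℝ => U (s * Complex.exp (θ * Complex.I)))
      (fderiv ℝ U (s * Complex.exp (θ * Complex.I)) (Complex.exp (θ * Complex.I))) s := by
  have h := (hU.differentiable one_ne_zero (s * Complex.exp (θ * Complex.I))).hasFDerivAt
  refine h.comp_hasDerivAt s ?_
  simpa using (Complex.ofRealCLM.hasDerivAt (x := s)).mul_const (Complex.exp (θ * Complex.I))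

lemma hasDerivAt_comp_angle {U : ℂ → ℂ} (hU : ContDiff ℝ 1 U) (s θ : ℝ) :
    HasDerivAt (fun θ : ℝ => U (s * Complex.exp (θ * Complex.I)))
      (s • fderiv ℝ U (s * Complex.exp (θ * Complex.I))
        (Complex.I * Complex.exp (θ * Complex.I))) θ := by
  have h := (hU.differentiable one_ne_zero (s * Complex.exp (θ * Complex.I))).hasFDerivAt
  rw [← map_smul]
  refine h.comp_hasDerivAt θ ?_
  have := (((Complex.ofRealCLM.hasDerivAt (x := θ)).mul_const Complex.I).cexp).const_mul (s : ℂ)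
  refine this.congr_deriv ?_
  simp [mul_comm]

lemma continuous_dbar {U : ℂ → ℂ} (hU : ContDiff ℝ 1 U) : Continuous (dbar U) := by
  have h := hU.continuous_fderiv one_ne_zero
  unfold dbar
  fun_prop

lemma integral_radial_deriv_eq {U : ℂ → ℂ} (hU : ContDiff ℝ 1 U) {s : ℝ} (hs : s ≠ 0) :
    ∫ θ in (-Real.pi)..Real.pi,
      fderiv ℝ U (s * Complex.exp (θ * Complex.I)) (Complex.exp (θ * Complex.I)) =
    ∫ θ in (-Real.pi)..Real.pi,
      2 * Complex.exp (-(θ * Complex.I)) * dbar U (s * Complex.exp (θ * Complex.I)) := by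
  have hf := hU.continuous_fderiv one_ne_zero
  have hd := continuous_dbar hU
  have hzero : ∫ θ in (-Real.pi)..Real.pi, s • fderiv ℝ U (s * Complex.exp (θ * Complex.I))
        (Complex.I * Complex.exp (θ * Complex.I)) = 0 := by
    rw [intervalIntegral.integral_eq_sub_of_hasDerivAt
      (fun θ _ => hasDerivAt_comp_angle hU s θ)]
    · have : Complex.exp (((-Real.pi : ℝ) : ℂ) * Complex.I)
          = Complex.exp ((Real.pi : ℂ) * Complex.I) := by
        rw [Complex.exp_pi_mul_I]; push_cast
        rw [neg_mul, Complex.exp_neg, Complex.exp_pi_mul_I]; norm_num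
      rw [this, sub_self]
    · exact Continuous.intervalIntegrable (by fun_prop) _ _
  rw [intervalIntegral.integral_smul] at hzero
  have hzero := (smul_eq_zero.1 hzero).resolve_left hs
  have : ∀ θ : ℝ, fderiv ℝ U (s * Complex.exp (θ * Complex.I)) (Complex.exp (θ * Complex.I)) =
      2 * Complex.exp (-(θ * Complex.I)) * dbar U (s * Complex.exp (θ * Complex.I)) -
      Complex.I * fderiv ℝ U (s * Complex.exp (θ * Complex.I))
        (Complex.I * Complex.exp (θ * Complex.I)) := fun θ =>
    apply_exp_mul_I_eq_dbar _ θ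
  simp_rw [this]
  rw [intervalIntegral.integral_sub, intervalIntegral.integral_const_mul, hzero]
  · simp
  · exact Continuous.intervalIntegrable (by fun_prop) _ _
  · exact Continuous.intervalIntegrable (by fun_prop) _ _

lemma norm_integral_circle_sub_center_le {U : ℂ → ℂ} (hU : ContDiff ℝ 1 U) {t r : ℝ}
    (ht : 0 ≤ t) (htr : t ≤ r) :
    ‖∫ θ in (-Real.pi)..Real.pi, (U (t * Complex.exp (θ * Complex.I)) - U 0)‖ ≤
      2 * ∫ s in (0 : ℝ)..r, ∫ θ in (-Real.pi)..Real.pi,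
        ‖dbar U (s * Complex.exp (θ * Complex.I))‖ := by
  have hpi : -Real.pi ≤ Real.pi := by linarith [Real.pi_pos]
  have hf := hU.continuous_fderiv one_ne_zero
  have hd := continuous_dbar hU
  have h1 : ∀ θ : ℝ, U (t * Complex.exp (θ * Complex.I)) - U 0 = ∫ s in (0 : ℝ)..t,
      fderiv ℝ U (s * Complex.exp (θ * Complex.I)) (Complex.exp (θ * Complex.I)) := by
    intro θ
    rw [intervalIntegral.integral_eq_sub_of_hasDerivAt
      (fun s _ => hasDerivAt_comp_radius hU θ s)]
    · simp
    · exact Continuous.intervalIntegrable (by fun_prop) _ _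
  simp_rw [h1]
  rw [intervalIntegral_swap_of_continuous (f := fun θ s : ℝ =>
    fderiv ℝ U (s * Complex.exp (θ * Complex.I)) (Complex.exp (θ * Complex.I)))
    (by fun_prop) hpi ht]
  have h2 : ∫ s in (0 : ℝ)..t, ∫ θ in (-Real.pi)..Real.pi,
      fderiv ℝ U (s * Complex.exp (θ * Complex.I)) (Complex.exp (θ * Complex.I)) =
      ∫ s in (0 : ℝ)..t, ∫ θ in (-Real.pi)..Real.pi,
      2 * Complex.exp (-(θ * Complex.I)) * dbar U (s * Complex.exp (θ * Complex.I)) := by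
    rw [intervalIntegral.integral_of_le ht, intervalIntegral.integral_of_le ht]
    exact setIntegral_congr_fun measurableSet_Ioc fun s hs =>
      integral_radial_deriv_eq hU hs.1.ne'
  have hJ : Continuous fun s : ℝ => ∫ θ in (-Real.pi)..Real.pi,
      ‖dbar U (s * Complex.exp (θ * Complex.I))‖ :=
    intervalIntegral.continuous_parametric_intervalIntegral_of_continuous' (by fun_prop) _ _
  have hJ0 : ∀ s : ℝ, 0 ≤ ∫ θ in (-Real.pi)..Real.pi,
      ‖dbar U (s * Complex.exp (θ * Complex.I))‖ := fun s =>
    intervalIntegral.integral_nonneg hpi fun θ _ => norm_nonneg _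
  rw [h2]
  calc _ ≤ ∫ s in (0 : ℝ)..t, 2 * ∫ θ in (-Real.pi)..Real.pi,
        ‖dbar U (s * Complex.exp (θ * Complex.I))‖ := by
        refine intervalIntegral.norm_integral_le_of_norm_le ht
          (Filter.Eventually.of_forall fun s _ => ?_) ((hJ.const_mul 2).intervalIntegrable _ _)
        rw [← intervalIntegral.integral_const_mul]
        refine intervalIntegral.norm_integral_le_of_norm_le hpi
          (Filter.Eventually.of_forall fun θ _ => ?_)
          (Continuous.intervalIntegrable (by fun_prop) _ _)
        rw [norm_mul, norm_mul, ← neg_mul, ← Complex.ofReal_neg, Complex.norm_exp_ofReal_mul_I]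
        simp
    _ = 2 * ∫ s in (0 : ℝ)..t, ∫ θ in (-Real.pi)..Real.pi,
        ‖dbar U (s * Complex.exp (θ * Complex.I))‖ := by
        rw [intervalIntegral.integral_const_mul]
    _ ≤ _ := by
        gcongr
        exact intervalIntegral.integral_mono_interval le_rfl ht htr
          (Filter.Eventually.of_forall hJ0) (hJ.intervalIntegrable _ _)

lemma sq_integral_mul_le {α : Type*} [MeasurableSpace α] {μ : Measure α} {f g : α → ℝ}
    (hf : Integrable (fun x => f x ^ 2) μ) (hg : Integrable (fun x => g x ^ 2) μ)
    (hfg : Integrable (fun x => f x * g x) μ) :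
    (∫ x, f x * g x ∂μ) ^ 2 ≤ (∫ x, f x ^ 2 ∂μ) * ∫ x, g x ^ 2 ∂μ := by
  have h : ∀ t : ℝ, 0 ≤ (∫ x, f x ^ 2 ∂μ) * (t * t) + (2 * ∫ x, f x * g x ∂μ) * t
      + ∫ x, g x ^ 2 ∂μ := by
    intro t
    have h0 : 0 ≤ ∫ x, (t * f x + g x) ^ 2 ∂μ := integral_nonneg fun x => sq_nonneg _
    have h1 : ∫ x, (t * f x + g x) ^ 2 ∂μ =
        ∫ x, (t * t) * f x ^ 2 + (2 * t) * (f x * g x) + g x ^ 2 ∂μ :=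
      integral_congr_ae (Filter.Eventually.of_forall fun x => by ring)
    have hsum : Integrable (fun x => (t * t) * f x ^ 2 + (2 * t) * (f x * g x)) μ :=
      (hf.const_mul _).add (hfg.const_mul _)
    rw [h1, integral_add hsum hg, integral_add (hf.const_mul _) (hfg.const_mul _),
      integral_const_mul,
      integral_const_mul] at h0
    linarith
  have := discrim_le_zero h
  rw [discrim] at this
  linarith

lemma integral_angle_gaussian (c s : ℝ) :
    ∫ θ in (-Real.pi)..Real.pi,
      s • Real.exp (-c * ‖(s : ℂ) * Complex.exp (θ * Complex.I)‖ ^ 2) =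
      2 * Real.pi * (s * Real.exp (-c * s ^ 2)) := by
  simp only [norm_mul, Complex.norm_exp_ofReal_mul_I, mul_one, Complex.norm_real,
    Real.norm_eq_abs, sq_abs, intervalIntegral.integral_const, smul_eq_mul]
  ring

lemma setIntegral_ball_gaussian {c r : ℝ} (hc : 0 < c) (hr : 0 ≤ r) :
    ∫ w in Metric.ball (0 : ℂ) r, Real.exp (-c * ‖w‖ ^ 2) =
      Real.pi / c * (1 - Real.exp (-c * r ^ 2)) := by
  rw [setIntegral_ball_eq_polar (by fun_prop) hr]
  simp_rw [integral_angle_gaussian]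
  have h2 : ∀ s ∈ Set.uIcc 0 r, HasDerivAt (fun s : ℝ => -(Real.pi / c) * Real.exp (-c * s ^ 2))
      (2 * Real.pi * (s * Real.exp (-c * s ^ 2))) s := by
    intro s _
    have := (((hasDerivAt_pow 2 s).const_mul (-c)).exp).const_mul (-(Real.pi / c))
    refine this.congr_deriv ?_
    field_simp
    simp
    ring
  rw [intervalIntegral.integral_eq_sub_of_hasDerivAt h2
    (Continuous.intervalIntegrable (by fun_prop) _ _)]
  simp
  ring

lemma norm_gaussian_mean_sub_center_le {U : ℂ → ℂ} (hU : ContDiff ℝ 1 U) {c r : ℝ}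
    (hc : 0 < c) (hr : 0 < r) :
    ‖((∫ w in Metric.ball (0 : ℂ) r, Real.exp (-c * ‖w‖ ^ 2) : ℝ) : ℂ)⁻¹ *
        (∫ w in Metric.ball (0 : ℂ) r, U w * Real.exp (-c * ‖w‖ ^ 2)) - U 0‖ ≤
      1 / Real.pi * ∫ s in (0 : ℝ)..r, ∫ θ in (-Real.pi)..Real.pi,
        ‖dbar U (s * Complex.exp (θ * Complex.I))‖ := by
  set Z := ∫ w in Metric.ball (0 : ℂ) r, Real.exp (-c * ‖w‖ ^ 2) with hZ
  set J := ∫ s in (0 : ℝ)..r, ∫ θ in (-Real.pi)..Real.pi,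
        ‖dbar U (s * Complex.exp (θ * Complex.I))‖ with hJ
  have hUc := hU.continuous
  have hpi : -Real.pi ≤ Real.pi := by linarith [Real.pi_pos]
  have hpos := Real.pi_pos
  have hZpos : 0 < Z := by
    rw [hZ, setIntegral_ball_gaussian hc hr.le]
    have : Real.exp (-c * r ^ 2) < 1 := Real.exp_lt_one_iff.2 (by nlinarith [pow_pos hr 2])
    have : 0 < 1 - Real.exp (-c * r ^ 2) := by linarith
    positivity
  have hZC : ((Z : ℝ) : ℂ) ≠ 0 := by exact_mod_cast hZpos.ne'
  have hbdd : ∀ {F : Type} [NormedAddCommGroup F] {k : ℂ → F}, Continuous k →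
      IntegrableOn k (Metric.ball (0 : ℂ) r) := fun {F} _ {k} hk =>
    (hk.continuousOn.integrableOn_compact (isCompact_closedBall (0 : ℂ) r)).mono_set
      Metric.ball_subset_closedBall
  have hsub : ∫ w in Metric.ball (0 : ℂ) r, (U w - U 0) * Real.exp (-c * ‖w‖ ^ 2) =
      (∫ w in Metric.ball (0 : ℂ) r, U w * Real.exp (-c * ‖w‖ ^ 2)) - U 0 * Z := by
    have hk : ∫ w in Metric.ball (0 : ℂ) r, U 0 * (Real.exp (-c * ‖w‖ ^ 2) : ℂ) = U 0 * Z := by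
      rw [integral_const_mul, hZ, ← integral_complex_ofReal]
    rw [← hk, ← integral_sub (hbdd (by fun_prop)) (hbdd (by fun_prop))]
    refine integral_congr_ae (Filter.Eventually.of_forall fun w => ?_)
    simp only
    ring
  have hbound : ‖∫ w in Metric.ball (0 : ℂ) r, (U w - U 0) * Real.exp (-c * ‖w‖ ^ 2)‖ ≤
      Z * (1 / Real.pi * J) := by
    have hZJ : Z * (1 / Real.pi * J) =
        ∫ s in (0 : ℝ)..r, s * Real.exp (-c * s ^ 2) * (2 * J) := by
      rw [intervalIntegral.integral_mul_const, hZ, setIntegral_ball_eq_polar (by fun_prop) hr.le]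
      simp_rw [integral_angle_gaussian]
      rw [intervalIntegral.integral_const_mul]
      generalize (∫ s in (0 : ℝ)..r, s * Real.exp (-c * s ^ 2)) = K
      field_simp
    rw [hZJ, setIntegral_ball_eq_polar (by fun_prop) hr.le]
    refine intervalIntegral.norm_integral_le_of_norm_le hr.le
      (Filter.Eventually.of_forall fun s hs => ?_)
      (Continuous.intervalIntegrable (by fun_prop) _ _)
    have h2 : ∀ θ : ℝ, s • ((U (s * Complex.exp (θ * Complex.I)) - U 0) *
        ((Real.exp (-c * ‖(s : ℂ) * Complex.exp (θ * Complex.I)‖ ^ 2) : ℝ) : ℂ)) =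
        ((s * Real.exp (-c * s ^ 2) : ℝ) : ℂ) *
          (U (s * Complex.exp (θ * Complex.I)) - U 0) := by
      intro θ
      simp only [norm_mul, Complex.norm_exp_ofReal_mul_I, mul_one, Complex.norm_real,
        Real.norm_eq_abs, sq_abs, Complex.real_smul]
      push_cast
      ring
    simp_rw [h2]
    rw [intervalIntegral.integral_const_mul, norm_mul, Complex.norm_real, Real.norm_eq_abs,
      abs_of_nonneg (mul_nonneg hs.1.le (Real.exp_pos _).le)]
    exact mul_le_mul_of_nonneg_left (norm_integral_circle_sub_center_le hU hs.1.le hs.2)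
      (mul_nonneg hs.1.le (Real.exp_pos _).le)
  have heq : ((Z : ℝ) : ℂ)⁻¹ *
        (∫ w in Metric.ball (0 : ℂ) r, U w * Real.exp (-c * ‖w‖ ^ 2)) - U 0 =
      ((Z : ℝ) : ℂ)⁻¹ *
        ∫ w in Metric.ball (0 : ℂ) r, (U w - U 0) * Real.exp (-c * ‖w‖ ^ 2) := by
    rw [hsub]
    field_simp
  rw [heq, norm_mul, norm_inv, Complex.norm_real, Real.norm_eq_abs, abs_of_pos hZpos,
    inv_mul_le_iff₀ hZpos]
  exact hbound

lemma sq_intervalIntegral_le {f : ℝ → ℝ → ℝ} (hf : Continuous (Function.uncurry f))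
    {r : ℝ} (hr : 0 ≤ r) :
    (∫ s in (0 : ℝ)..r, ∫ θ in (-Real.pi)..Real.pi, f s θ) ^ 2 ≤
      (2 * Real.pi * r) * ∫ s in (0 : ℝ)..r, ∫ θ in (-Real.pi)..Real.pi, f s θ ^ 2 := by
  have hpi : -Real.pi ≤ Real.pi := by linarith [Real.pi_pos]
  simp_rw [intervalIntegral.integral_of_le hr, intervalIntegral.integral_of_le hpi]
  have h1 : Integrable (fun p : ℝ × ℝ => f p.1 p.2) _ :=
    integrable_prod_Ioc_of_continuous hf 0 r (-Real.pi) Real.pi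
  have h2 : Integrable (fun p : ℝ × ℝ => f p.1 p.2 ^ 2) _ :=
    integrable_prod_Ioc_of_continuous (hf.pow 2) 0 r (-Real.pi) Real.pi
  have h3 := sq_integral_mul_le (μ := (volume.restrict (Set.Ioc 0 r)).prod
    (volume.restrict (Set.Ioc (-Real.pi) Real.pi))) (f := fun _ => (1 : ℝ))
    (g := fun p => f p.1 p.2) (by simp) h2 (by simpa using h1)
  simp only [one_mul] at h3
  rw [integral_prod _ h2, integral_prod _ h1] at h3
  refine h3.trans (le_of_eq ?_)
  congr 1
  simp [Measure.real, Measure.prod_restrict, Measure.prod_prod, Real.volume_Ioc, hr,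
    Real.pi_pos.le]
  ring

lemma dbar_mul_of_differentiable {u E : ℂ → ℂ} {w : ℂ} (hu : DifferentiableAt ℝ u w)
    (hE : DifferentiableAt ℂ E w) : dbar (fun w => u w * E w) w = dbar u w * E w := by
  have hE' : HasFDerivAt E ((fderiv ℂ E w).restrictScalars ℝ) w :=
    hE.hasFDerivAt.restrictScalars ℝ
  have h := hu.hasFDerivAt.mul hE'
  have hI : fderiv ℂ E w Complex.I = Complex.I * fderiv ℂ E w 1 := by
    rw [← smul_eq_mul, ← map_smul]; simp
  unfold dbar
  rw [show (fun w => u w * E w) = u * E from rfl, h.fderiv]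
  simp only [_root_.add_apply, _root_.smul_apply,
    ContinuousLinearMap.coe_restrictScalars', smul_eq_mul, hI]
  linear_combination (u w * fderiv ℂ E w 1 / 2) * Complex.I_sq

lemma dbar_comp_const_add (u : ℂ → ℂ) (z w : ℂ) :
    dbar (fun w => u (z + w)) w = dbar u (z + w) := by
  unfold dbar
  rw [fderiv_comp_add_left]

lemma integrableOn_ball_of_continuous {F : Type*} [NormedAddCommGroup F] {k : ℂ → F}
    (hk : Continuous k) (r : ℝ) : IntegrableOn k (Metric.ball (0 : ℂ) r) :=
  (hk.continuousOn.integrableOn_compact (isCompact_closedBall (0 : ℂ) r)).mono_set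
    Metric.ball_subset_closedBall

/-- A linear functional, a Gaussian average twisted by a local holomorphic factor, which almost
reproduces the weighted value `u z * exp (-ψ z / h)` when `∂̄ u` is small, and whose norm is
controlled by the mass of the Gaussian. -/
lemma exists_gaussian_functional {ψ : ℂ → ℝ} (hψc : Continuous ψ) (hψp : PeriodicC ψ)
    {h r b : ℝ} (hh : 0 < h) (hr : 0 < r) (hrpi : r ≤ Real.pi) (hb : 0 < b) (z α β : ℂ)
    (hle : ∀ w : ℂ, ‖w‖ ≤ r → ψ (z + w) ≤ ψ z + (α * w + β * w ^ 2).re + b * ‖w‖ ^ 2) :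
    ∃ F : (ℂ → ℂ) → ℂ,
      (∀ (n : ℕ) (c : Fin n → ℂ) (e : Fin n → ℂ → ℂ), (∀ j, Continuous (e j)) →
        F (fun w => ∑ j, c j * e j w) = ∑ j, c j * F (e j)) ∧
      (∀ u : ℂ → ℂ, Continuous u → PeriodicC u →
        ‖F u‖ ^ 2 ≤
          (Real.pi / (2 * b / h) * (1 - Real.exp (-(2 * b / h) * r ^ 2)))⁻¹ * wInt ψ h u) ∧
      (∀ u : ℂ → ℂ, ContDiff ℝ 1 u →
        ‖F u - u z * (Real.exp (-ψ z / h) : ℝ)‖ ^ 2 ≤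
          2 * r / Real.pi * Real.exp (2 * b * r ^ 2 / h) *
            ∫ s in (0 : ℝ)..r, ∫ θ in (-Real.pi)..Real.pi,
              ‖dbar u (z + s * Complex.exp (θ * Complex.I))‖ ^ 2 *
                Real.exp (-2 * ψ (z + s * Complex.exp (θ * Complex.I)) / h)) := by
  set c : ℝ := 2 * b / h with hc
  have hcpos : 0 < c := by positivity
  have hpipos := Real.pi_pos
  set Z : ℝ := Real.pi / c * (1 - Real.exp (-c * r ^ 2)) with hZ
  have hZpos : 0 < Z := by
    have : Real.exp (-c * r ^ 2) < 1 := Real.exp_lt_one_iff.2 (by nlinarith [pow_pos hr 2])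
    have : 0 < 1 - Real.exp (-c * r ^ 2) := by linarith
    positivity
  have hZint := setIntegral_ball_gaussian hcpos hr.le
  rw [← hZ] at hZint
  set g : ℂ → ℂ := fun w => Complex.exp (-(ψ z + (α * w + β * w ^ 2)) / h) with hg
  have hgd : Differentiable ℂ g := by rw [hg]; fun_prop
  have hgc : Continuous g := hgd.continuous
  have hgnorm : ∀ w, ‖g w‖ = Real.exp (-(ψ z + (α * w + β * w ^ 2).re) / h) := by
    intro w
    rw [hg, Complex.norm_exp, Complex.div_ofReal_re, Complex.neg_re, Complex.add_re,
      Complex.ofReal_re]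
  have hg0 : g 0 = (Real.exp (-ψ z / h) : ℝ) := by simp [hg]
  refine ⟨fun u => (Z : ℂ)⁻¹ *
    ∫ w in Metric.ball (0 : ℂ) r, (u (z + w) * g w) * Real.exp (-c * ‖w‖ ^ 2), ?_, ?_, ?_⟩
  · intro n d e he
    have hterm : ∀ j, IntegrableOn
        (fun w => d j * (e j (z + w) * g w * (Real.exp (-c * ‖w‖ ^ 2) : ℝ)))
        (Metric.ball (0 : ℂ) r) := fun j =>
      integrableOn_ball_of_continuous (by have := he j; fun_prop) r
    have hsum : ∀ w, (∑ j, d j * e j (z + w)) * g w * (Real.exp (-c * ‖w‖ ^ 2) : ℝ) =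
        ∑ j, d j * (e j (z + w) * g w * (Real.exp (-c * ‖w‖ ^ 2) : ℝ)) := by
      intro w
      rw [Finset.sum_mul, Finset.sum_mul]
      exact Finset.sum_congr rfl fun j _ => by ring
    simp_rw [hsum]
    rw [integral_finsetSum _ (fun j _ => hterm j), Finset.mul_sum]
    refine Finset.sum_congr rfl fun j _ => ?_
    rw [integral_const_mul]
    ring
  · intro u hu hup
    have hball : ∀ {k : ℂ → ℝ}, Continuous k → IntegrableOn k (Metric.ball (0 : ℂ) r) :=
      fun hk => integrableOn_ball_of_continuous hk r
    have h1 : ‖∫ w in Metric.ball (0 : ℂ) r, (u (z + w) * g w) * Real.exp (-c * ‖w‖ ^ 2)‖ ≤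
        ∫ w in Metric.ball (0 : ℂ) r, (‖u (z + w) * g w‖ * Real.exp (-c * ‖w‖ ^ 2 / 2)) *
          Real.exp (-c * ‖w‖ ^ 2 / 2) := by
      refine (norm_integral_le_integral_norm _).trans (le_of_eq ?_)
      refine integral_congr_ae (Filter.Eventually.of_forall fun w => ?_)
      simp only
      rw [mul_assoc ‖_‖, ← Real.exp_add, add_halves, norm_mul _ ((_ : ℝ) : ℂ),
        Complex.norm_real, Real.norm_eq_abs, abs_of_pos (Real.exp_pos _)]
    have h2 := sq_integral_mul_le (μ := volume.restrict (Metric.ball (0 : ℂ) r))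
      (f := fun w => ‖u (z + w) * g w‖ * Real.exp (-c * ‖w‖ ^ 2 / 2))
      (g := fun w => Real.exp (-c * ‖w‖ ^ 2 / 2))
      (hball (by fun_prop)) (hball (by fun_prop)) (hball (by fun_prop))
    have h3 : ∫ w in Metric.ball (0 : ℂ) r, Real.exp (-c * ‖w‖ ^ 2 / 2) ^ 2 = Z := by
      rw [← hZint]
      refine integral_congr_ae (Filter.Eventually.of_forall fun w => ?_)
      simp only
      rw [sq, ← Real.exp_add, add_halves]
    have h4 : ∫ w in Metric.ball (0 : ℂ) r,
        (‖u (z + w) * g w‖ * Real.exp (-c * ‖w‖ ^ 2 / 2)) ^ 2 ≤ wInt ψ h u := by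
      refine le_trans ?_ ((hup.comp_two hψp
        (fun a b => ‖a‖ ^ 2 * Real.exp (-2 * b / h))).setIntegral_ball_le
        (by fun_prop) (fun w => by positivity) z hrpi)
      refine setIntegral_mono_on (hball (by fun_prop)) (hball (by fun_prop))
        Metric.isOpen_ball.measurableSet fun w hw => ?_
      rw [mem_ball_zero_iff] at hw
      rw [norm_mul, mul_pow, mul_pow, mul_assoc, hgnorm, ← Real.exp_nat_mul, ← Real.exp_nat_mul,
        ← Real.exp_add]
      refine mul_le_mul_of_nonneg_left (Real.exp_le_exp.2 ?_) (by positivity)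
      have h5 := hle w hw.le
      rw [hc]
      push_cast
      have h6 : 2 * (-(ψ z + (α * w + β * w ^ 2).re) / h) + 2 * (-(2 * b / h) * ‖w‖ ^ 2 / 2) =
        -2 * (ψ z + (α * w + β * w ^ 2).re + b * ‖w‖ ^ 2) / h := by field_simp; ring
      rw [h6]
      gcongr ?_ / h
      linarith
    rw [h3] at h2
    rw [norm_mul, mul_pow, norm_inv, Complex.norm_real, Real.norm_eq_abs, abs_of_pos hZpos]
    have h7 : ‖∫ w in Metric.ball (0 : ℂ) r, (u (z + w) * g w) * Real.exp (-c * ‖w‖ ^ 2)‖ ^ 2 ≤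
        wInt ψ h u * Z :=
      (pow_le_pow_left₀ (norm_nonneg _) h1 2).trans
        (h2.trans (mul_le_mul_of_nonneg_right h4 hZpos.le))
    calc _ ≤ Z⁻¹ ^ 2 * (wInt ψ h u * Z) := by gcongr
      _ = _ := by field_simp
  · intro u hu
    have hgd' : ContDiff ℝ 1 g := by
      rw [hg]; fun_prop
    have hU : ContDiff ℝ 1 (fun w => u (z + w) * g w) := by fun_prop
    have hdb := continuous_dbar hu
    have hdbar : ∀ w, dbar (fun w => u (z + w) * g w) w = dbar u (z + w) * g w := by
      intro w
      have hd : DifferentiableAt ℝ (fun w => u (z + w)) w :=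
        ((hu.comp (contDiff_const.add contDiff_id)).differentiable one_ne_zero) w
      rw [dbar_mul_of_differentiable hd (hgd w), dbar_comp_const_add]
    have h1 := norm_gaussian_mean_sub_center_le hU hcpos hr
    rw [hZint] at h1
    simp only [add_zero, hg0, hdbar] at h1
    have h2 := sq_intervalIntegral_le (r := r) (f := fun s θ : ℝ =>
      ‖dbar u (z + s * Complex.exp (θ * Complex.I)) * g (s * Complex.exp (θ * Complex.I))‖)
      (by fun_prop) hr.le
    have h3 : ∫ s in (0 : ℝ)..r, ∫ θ in (-Real.pi)..Real.pi,
        ‖dbar u (z + s * Complex.exp (θ * Complex.I)) *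
          g (s * Complex.exp (θ * Complex.I))‖ ^ 2 ≤
        Real.exp (2 * b * r ^ 2 / h) * ∫ s in (0 : ℝ)..r, ∫ θ in (-Real.pi)..Real.pi,
              ‖dbar u (z + s * Complex.exp (θ * Complex.I))‖ ^ 2 *
                Real.exp (-2 * ψ (z + s * Complex.exp (θ * Complex.I)) / h) := by
      simp_rw [← intervalIntegral.integral_const_mul]
      refine intervalIntegral.integral_mono_on hr.le
        (Continuous.intervalIntegrable
          (intervalIntegral.continuous_parametric_intervalIntegral_of_continuous'
            (by fun_prop) _ _) _ _)
        (Continuous.intervalIntegrable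
          (intervalIntegral.continuous_parametric_intervalIntegral_of_continuous'
            (by fun_prop) _ _) _ _) fun s hs => ?_
      refine intervalIntegral.integral_mono_on (by linarith)
        (Continuous.intervalIntegrable (by fun_prop) _ _)
        (Continuous.intervalIntegrable (by fun_prop) _ _) fun θ _ => ?_
      set w : ℂ := s * Complex.exp (θ * Complex.I) with hw
      have hwn : ‖w‖ = s := by
        rw [hw, norm_mul, Complex.norm_exp_ofReal_mul_I, mul_one, Complex.norm_real,
          Real.norm_eq_abs, abs_of_nonneg hs.1]
      have hwr : ‖w‖ ≤ r := hwn.trans_le hs.2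
      clear_value w
      rw [norm_mul, mul_pow, hgnorm, ← Real.exp_nat_mul,
        mul_left_comm (Real.exp (2 * b * r ^ 2 / h)), ← Real.exp_add]
      refine mul_le_mul_of_nonneg_left (Real.exp_le_exp.2 ?_) (by positivity)
      have h5 := hle w hwr
      have h6 : b * ‖w‖ ^ 2 ≤ b * r ^ 2 := by gcongr
      rw [← add_div]
      push_cast
      rw [← mul_div_assoc]
      gcongr ?_ / h
      linarith
    calc _ ≤ (1 / Real.pi * ∫ s in (0 : ℝ)..r, ∫ θ in (-Real.pi)..Real.pi,
          ‖dbar u (z + s * Complex.exp (θ * Complex.I)) *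
            g (s * Complex.exp (θ * Complex.I))‖) ^ 2 :=
          pow_le_pow_left₀ (norm_nonneg _) h1 2
      _ ≤ (1 / Real.pi) ^ 2 * (2 * Real.pi * r * (Real.exp (2 * b * r ^ 2 / h) *
          ∫ s in (0 : ℝ)..r, ∫ θ in (-Real.pi)..Real.pi,
              ‖dbar u (z + s * Complex.exp (θ * Complex.I))‖ ^ 2 *
                Real.exp (-2 * ψ (z + s * Complex.exp (θ * Complex.I)) / h))) := by
          rw [mul_pow]
          gcongr
          exact h2.trans (mul_le_mul_of_nonneg_left h3 (by positivity))
      _ = _ := by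
          generalize (∫ s in (0 : ℝ)..r, ∫ θ in (-Real.pi)..Real.pi,
              ‖dbar u (z + s * Complex.exp (θ * Complex.I))‖ ^ 2 *
                Real.exp (-2 * ψ (z + s * Complex.exp (θ * Complex.I)) / h)) = K
          field_simp

lemma PeriodicC.eq_zero_of_wInt_eq_zero {φ : ℂ → ℝ} (hφ : Continuous φ) {h : ℝ} {u : ℂ → ℂ}
    (hu : Continuous u) (hup : PeriodicC u) (h0 : wInt φ h u = 0) : u = 0 := by
  have hc : Continuous fun z => ‖u z‖ ^ 2 * Real.exp (-2 * φ z / h) := by fun_prop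
  have h1 := (setIntegral_eq_zero_iff_of_nonneg_ae
    (Filter.Eventually.of_forall fun z => by positivity) hc.integrableOn_Efd).1 h0
  have hsub : Efd ⊆ closure (interior Efd) := by
    have hE : Efd = Set.Ico 0 (2 * Real.pi) ×ℂ Set.Ico 0 (2 * Real.pi) := rfl
    rw [hE, Complex.interior_reProdIm, Complex.closure_reProdIm, interior_Ico,
      closure_Ioo Real.two_pi_pos.ne]
    exact fun z hz => ⟨Set.Ico_subset_Icc_self hz.1, Set.Ico_subset_Icc_self hz.2⟩
  have h2 := Measure.eqOn_of_ae_eq h1 hc.continuousOn continuousOn_const hsub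
  funext z
  obtain ⟨m, n, hmn⟩ := exists_lattice_add_mem_Efd z
  have h3 := h2 hmn
  rw [← hup.add_lattice m n z]
  simpa [Real.exp_ne_zero] using h3

lemma exists_orthonormal_family {φ : ℂ → ℝ} (hφ : Continuous φ) (h : ℝ)
    (V : Submodule ℂ (ℂ → ℂ)) [FiniteDimensional ℂ V]
    (hV : ∀ u ∈ V, Continuous u ∧ PeriodicC u) :
    ∃ e : Fin (Module.finrank ℂ V) → ℂ → ℂ, (∀ j, e j ∈ V) ∧
      ∀ c : Fin (Module.finrank ℂ V) → ℂ,
        wInt φ h (fun z => ∑ j, c j * e j z) = ∑ j, ‖c j‖ ^ 2 := by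
  have hint : ∀ u v : V, IntegrableOn (fun z => starRingEnd ℂ (u.1 z) * v.1 z *
      (Real.exp (-2 * φ z / h) : ℝ)) Efd := fun u v => by
    have h1 := (hV u.1 u.2).1
    have h2 := (hV v.1 v.2).1
    refine Continuous.integrableOn_Efd ?_
    fun_prop
  have hself : ∀ u : V, ∫ z in Efd, starRingEnd ℂ (u.1 z) * u.1 z *
      ((Real.exp (-2 * φ z / h) : ℝ) : ℂ) = (wInt φ h u.1 : ℝ) := by
    intro u
    rw [wInt, ← integral_complex_ofReal]
    refine integral_congr_ae (Filter.Eventually.of_forall fun z => ?_)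
    simp only
    rw [mul_comm (starRingEnd ℂ _), Complex.mul_conj, Complex.normSq_eq_norm_sq]
    push_cast
    rfl
  let core : InnerProductSpace.Core ℂ V :=
    { inner := fun u v => ∫ z in Efd, starRingEnd ℂ (u.1 z) * v.1 z *
        (Real.exp (-2 * φ z / h) : ℝ)
      conj_inner_symm := fun u v => by
        rw [← integral_conj]
        refine integral_congr_ae (Filter.Eventually.of_forall fun z => ?_)
        simp only [map_mul, Complex.conj_conj, Complex.conj_ofReal]
        ring
      re_inner_nonneg := fun u => by
        show 0 ≤ RCLike.re (∫ z in Efd, starRingEnd ℂ (u.1 z) * u.1 z *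
          ((Real.exp (-2 * φ z / h) : ℝ) : ℂ))
        rw [hself]
        exact integral_nonneg fun z => by positivity
      add_left := fun u v w => by
        rw [← integral_add (hint u w) (hint v w)]
        refine integral_congr_ae (Filter.Eventually.of_forall fun z => ?_)
        simp only [Submodule.coe_add, Pi.add_apply, map_add]
        ring
      smul_left := fun u v r => by
        rw [← integral_const_mul]
        refine integral_congr_ae (Filter.Eventually.of_forall fun z => ?_)
        simp only [Submodule.coe_smul, Pi.smul_apply, smul_eq_mul, map_mul]
        ring
      definite := fun u hu => by
        have hu : ∫ z in Efd, starRingEnd ℂ (u.1 z) * u.1 z *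
          ((Real.exp (-2 * φ z / h) : ℝ) : ℂ) = 0 := hu
        rw [hself] at hu
        exact Subtype.ext ((hV u.1 u.2).2.eq_zero_of_wInt_eq_zero hφ (hV u.1 u.2).1
          (by exact_mod_cast hu)) }
  let _ : NormedAddCommGroup V := core.toNormedAddCommGroup
  let _ : InnerProductSpace ℂ V := InnerProductSpace.ofCore core.toCore
  let o := stdOrthonormalBasis ℂ V
  refine ⟨fun j => (o j).1, fun j => (o j).2, fun c => ?_⟩
  have h1 : (fun z => ∑ j, c j * (o j).1 z) = (∑ j, c j • o j : V).1 := by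
    funext z
    simp
  have h2 : inner ℂ (∑ j, c j • o j) (∑ j, c j • o j) = ∑ j, starRingEnd ℂ (c j) * c j :=
    o.orthonormal.inner_sum c c Finset.univ
  have h3 : inner ℂ (∑ j, c j • o j) (∑ j, c j • o j) =
      ((wInt φ h (∑ j, c j • o j : V).1 : ℝ) : ℂ) := hself _
  rw [h1]
  rw [h3] at h2
  have h4 : ∑ j, starRingEnd ℂ (c j) * c j = ((∑ j, ‖c j‖ ^ 2 : ℝ) : ℂ) := by
    push_cast
    refine Finset.sum_congr rfl fun j _ => ?_
    rw [mul_comm, Complex.mul_conj, Complex.normSq_eq_norm_sq]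
    push_cast
    rfl
  rw [h4] at h2
  exact_mod_cast h2

lemma norm_sq_le_of_norm_sub_sq_le {a x : ℝ} (ha : 0 < a) {p q : ℂ} (h : ‖p - q‖ ^ 2 ≤ x) :
    ‖q‖ ^ 2 ≤ (1 + a) * ‖p‖ ^ 2 + (1 + 1 / a) * x := by
  have h1 : ‖q‖ ≤ ‖p‖ + ‖p - q‖ := by
    have := norm_sub_norm_le q p
    rw [norm_sub_rev] at this
    linarith
  have h2 : ‖q‖ ^ 2 ≤ (‖p‖ + ‖p - q‖) ^ 2 := by gcongr
  have h3 : 2 * (‖p‖ * ‖p - q‖) ≤ a * ‖p‖ ^ 2 + 1 / a * ‖p - q‖ ^ 2 := by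
    have h4 : 0 ≤ (a * ‖p‖ - ‖p - q‖) ^ 2 / a := by positivity
    have h5 : (a * ‖p‖ - ‖p - q‖) ^ 2 / a =
      a * ‖p‖ ^ 2 + 1 / a * ‖p - q‖ ^ 2 - 2 * (‖p‖ * ‖p - q‖) := by field_simp; ring
    linarith
  have h6 : (1 + 1 / a) * ‖p - q‖ ^ 2 ≤ (1 + 1 / a) * x := by gcongr
  nlinarith

/-- Pointwise bound for the weighted density of an orthonormal family of almost holomorphic
functions. -/
lemma density_le {ψ : ℂ → ℝ} (hψc : Continuous ψ) (hψp : PeriodicC ψ)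
    {h r b a : ℝ} (hh : 0 < h) (hr : 0 < r) (hrpi : r ≤ Real.pi) (hb : 0 < b) (ha : 0 < a)
    (z α β : ℂ)
    (hle : ∀ w : ℂ, ‖w‖ ≤ r → ψ (z + w) ≤ ψ z + (α * w + β * w ^ 2).re + b * ‖w‖ ^ 2)
    {n : ℕ} {e : Fin n → ℂ → ℂ} (hes : ∀ j, ContDiff ℝ 1 (e j)) (hep : ∀ j, PeriodicC (e j))
    (horth : ∀ c : Fin n → ℂ, wInt ψ h (fun z => ∑ j, c j * e j z) = ∑ j, ‖c j‖ ^ 2) :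
    ∑ j, ‖e j z‖ ^ 2 * Real.exp (-2 * ψ z / h) ≤
      (1 + a) * (Real.pi / (2 * b / h) * (1 - Real.exp (-(2 * b / h) * r ^ 2)))⁻¹ +
      (1 + 1 / a) * ∑ j, 2 * r / Real.pi * Real.exp (2 * b * r ^ 2 / h) *
            ∫ s in (0 : ℝ)..r, ∫ θ in (-Real.pi)..Real.pi,
              ‖dbar (e j) (z + s * Complex.exp (θ * Complex.I))‖ ^ 2 *
                Real.exp (-2 * ψ (z + s * Complex.exp (θ * Complex.I)) / h) := by
  obtain ⟨F, hlin, hnorm, herr⟩ := exists_gaussian_functional hψc hψp hh hr hrpi hb z α β hle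
  set Y := (Real.pi / (2 * b / h) * (1 - Real.exp (-(2 * b / h) * r ^ 2)))⁻¹ with hY
  have hY0 : 0 ≤ Y := by
    have h1 : Real.exp (-(2 * b / h) * r ^ 2) ≤ 1 := by
      rw [Real.exp_le_one_iff, neg_mul, neg_nonpos]
      positivity
    have h2 : 0 ≤ 1 - Real.exp (-(2 * b / h) * r ^ 2) := by linarith
    have := Real.pi_pos
    positivity
  set T := ∑ j, ‖F (e j)‖ ^ 2 with hT
  have hT0 : 0 ≤ T := Finset.sum_nonneg fun j _ => by positivity
  have hTY : T ≤ Y := by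
    have h1 := hlin n (fun j => starRingEnd ℂ (F (e j))) e (fun j => (hes j).continuous)
    have h2 : ∑ j, starRingEnd ℂ (F (e j)) * F (e j) = (T : ℂ) := by
      rw [hT]
      push_cast
      refine Finset.sum_congr rfl fun j _ => ?_
      rw [mul_comm, Complex.mul_conj, Complex.normSq_eq_norm_sq]
      push_cast
      rfl
    rw [h2] at h1
    have h3 := hnorm (fun w => ∑ j, starRingEnd ℂ (F (e j)) * e j w)
      (continuous_finsetSum _ fun j _ => continuous_const.mul (hes j).continuous)
      (fun z => ⟨Finset.sum_congr rfl fun j _ => by rw [(hep j z).1],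
        Finset.sum_congr rfl fun j _ => by rw [(hep j z).2]⟩)
    rw [h1, horth, Complex.norm_real, Real.norm_eq_abs, sq_abs] at h3
    simp only [RCLike.norm_conj] at h3
    rw [← hT] at h3
    rcases hT0.eq_or_lt with h0 | h0
    · rw [← h0]; exact hY0
    · rw [sq] at h3
      exact le_of_mul_le_mul_right h3 h0
  calc _ ≤ ∑ j, ((1 + a) * ‖F (e j)‖ ^ 2 + (1 + 1 / a) *
            (2 * r / Real.pi * Real.exp (2 * b * r ^ 2 / h) *
            ∫ s in (0 : ℝ)..r, ∫ θ in (-Real.pi)..Real.pi,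
              ‖dbar (e j) (z + s * Complex.exp (θ * Complex.I))‖ ^ 2 *
                Real.exp (-2 * ψ (z + s * Complex.exp (θ * Complex.I)) / h))) := by
        refine Finset.sum_le_sum fun j _ => ?_
        have h1 := norm_sq_le_of_norm_sub_sq_le ha (herr (e j) (hes j))
        rw [norm_mul, mul_pow, Complex.norm_real, Real.norm_eq_abs, abs_of_pos (Real.exp_pos _),
          ← Real.exp_nat_mul] at h1
        have h2 : -2 * ψ z / h = (2 : ℕ) * (-ψ z / h) := by push_cast; ring
        rw [h2]
        exact h1
    _ = (1 + a) * T + _ := by rw [Finset.sum_add_distrib, ← Finset.mul_sum, ← Finset.mul_sum]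
    _ ≤ _ := by gcongr

lemma setIntegral_Efd_intervalIntegral_swap {f : ℝ → ℂ → ℝ}
    (hf : Continuous (Function.uncurry f)) (a b : ℝ) :
    ∫ z in Efd, ∫ x in a..b, f x z = ∫ x in a..b, ∫ z in Efd, f x z := by
  refine (intervalIntegral_integral_swap ?_).symm
  rw [Measure.prod_restrict]
  refine IntegrableOn.mono_set (t := Set.uIcc a b ×ˢ
    (Set.Icc (-1) (2 * Real.pi + 1) ×ℂ Set.Icc (-1) (2 * Real.pi + 1))) ?_
    (Set.prod_mono Set.uIoc_subset_uIcc ?_)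
  · exact hf.continuousOn.integrableOn_compact (isCompact_uIcc.prod isCompact_reProdIm_box)
  · rintro z ⟨⟨h1, h2⟩, ⟨h3, h4⟩⟩
    exact ⟨⟨by linarith, by linarith⟩, ⟨by linarith, by linarith⟩⟩

lemma continuous_polar_integral {H : ℂ → ℝ} (hH : Continuous H) (r : ℝ) :
    Continuous fun z : ℂ => ∫ s in (0 : ℝ)..r, ∫ θ in (-Real.pi)..Real.pi,
      H (z + s * Complex.exp (θ * Complex.I)) :=
  intervalIntegral.continuous_parametric_intervalIntegral_of_continuous'
    (intervalIntegral.continuous_parametric_intervalIntegral_of_continuous'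
      (f := fun (p : ℂ × ℝ) (θ : ℝ) => H (p.1 + p.2 * Complex.exp (θ * Complex.I)))
      (by fun_prop) _ _) _ _

lemma PeriodicC.setIntegral_polar_integral {H : ℂ → ℝ} (hH : Continuous H) (hp : PeriodicC H)
    (r : ℝ) :
    ∫ z in Efd, ∫ s in (0 : ℝ)..r, ∫ θ in (-Real.pi)..Real.pi,
      H (z + s * Complex.exp (θ * Complex.I)) = 2 * Real.pi * r * ∫ z in Efd, H z := by
  rw [setIntegral_Efd_intervalIntegral_swap (f := fun (s : ℝ) (z : ℂ) =>
    ∫ θ in (-Real.pi)..Real.pi, H (z + s * Complex.exp (θ * Complex.I)))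
    (intervalIntegral.continuous_parametric_intervalIntegral_of_continuous'
      (f := fun (p : ℝ × ℂ) (θ : ℝ) => H (p.2 + p.1 * Complex.exp (θ * Complex.I)))
      (by fun_prop) _ _)]
  have h1 : ∀ s : ℝ, ∫ z in Efd, ∫ θ in (-Real.pi)..Real.pi,
      H (z + s * Complex.exp (θ * Complex.I)) = 2 * Real.pi * ∫ z in Efd, H z := by
    intro s
    rw [setIntegral_Efd_intervalIntegral_swap (f := fun (θ : ℝ) (z : ℂ) =>
      H (z + s * Complex.exp (θ * Complex.I))) (by fun_prop)]
    simp_rw [hp.setIntegral_Efd_comp_add hH]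
    rw [intervalIntegral.integral_const, smul_eq_mul]
    ring
  simp_rw [h1]
  rw [intervalIntegral.integral_const, smul_eq_mul]
  ring

/-- Non-asymptotic dimension bound for a space of almost holomorphic functions. -/
lemma finrank_le_of_local_weight {ψ b : ℂ → ℝ} (hψc : Continuous ψ) (hψp : PeriodicC ψ)
    (hbc : Continuous b) {h r b₀ B a η : ℝ} (hh : 0 < h) (hr : 0 < r) (hrpi : r ≤ Real.pi)
    (hb₀ : 0 < b₀) (hb : ∀ z, b₀ ≤ b z) (hB : ∀ z, b z ≤ B) (ha : 0 < a)
    (hle : ∀ z, ∃ α β : ℂ, ∀ w : ℂ, ‖w‖ ≤ r →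
      ψ (z + w) ≤ ψ z + (α * w + β * w ^ 2).re + b z * ‖w‖ ^ 2)
    (V : Submodule ℂ (ℂ → ℂ)) [FiniteDimensional ℂ V]
    (hV : ∀ u ∈ V, ContDiff ℝ 1 u ∧ PeriodicC u)
    (hη : ∀ u ∈ V, wInt ψ h (dbar u) ≤ η * wInt ψ h u) :
    (Module.finrank ℂ V : ℝ) ≤
      (1 + a) * (2 / (Real.pi * h) * (1 - Real.exp (-(2 * b₀ / h) * r ^ 2))⁻¹ * ∫ z in Efd, b z) +
      (1 + 1 / a) * (Module.finrank ℂ V * (4 * r ^ 2 * Real.exp (2 * B * r ^ 2 / h) * η)) := by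
  obtain ⟨e, heV, horth⟩ := exists_orthonormal_family hψc h V
    (fun u hu => ⟨(hV u hu).1.continuous, (hV u hu).2⟩)
  generalize Module.finrank ℂ V = n at e heV horth ⊢
  have hpi := Real.pi_pos
  have hone : ∀ j, wInt ψ h (e j) = 1 := by
    intro j
    have h1 := horth (Pi.single j 1)
    have h2 : (fun z => ∑ i, (Pi.single j 1 : Fin n → ℂ) i * e i z) = e j := by
      funext z
      rw [Finset.sum_eq_single j] <;> simp +contextual
    rw [h2, Finset.sum_eq_single j] at h1
    · simpa using h1
    · intro i _ hij
      simp [hij]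
    · simp
  set H : Fin n → ℂ → ℝ := fun j z => ‖dbar (e j) z‖ ^ 2 * Real.exp (-2 * ψ z / h) with hH
  have hHc : ∀ j, Continuous (H j) := fun j => by
    have := continuous_dbar (hV _ (heV j)).1
    simp only [hH]
    fun_prop
  have hHp : ∀ j, PeriodicC (H j) := fun j =>
    (hV _ (heV j)).2.dbar.comp_two hψp (fun x y => ‖x‖ ^ 2 * Real.exp (-2 * y / h))
  have hH0 : ∀ j z, 0 ≤ H j z := fun j z => by simp only [hH]; positivity
  set J : Fin n → ℂ → ℝ := fun j z => ∫ s in (0 : ℝ)..r, ∫ θ in (-Real.pi)..Real.pi,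
      H j (z + s * Complex.exp (θ * Complex.I)) with hJ
  have hJc : ∀ j, Continuous (J j) := fun j => continuous_polar_integral (hHc j) r
  have hJ0 : ∀ j z, 0 ≤ J j z := fun j z =>
    intervalIntegral.integral_nonneg hr.le fun s _ =>
      intervalIntegral.integral_nonneg (by linarith) fun θ _ => hH0 j _
  set D := (1 - Real.exp (-(2 * b₀ / h) * r ^ 2))⁻¹ with hD
  have hexp : ∀ {x : ℝ}, 0 < x → 0 < 1 - Real.exp (-(2 * x / h) * r ^ 2) := by
    intro x hx
    have : Real.exp (-(2 * x / h) * r ^ 2) < 1 := by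
      rw [Real.exp_lt_one_iff, neg_mul, neg_lt_zero]
      positivity
    linarith
  have hpt : ∀ z, ∑ j, ‖e j z‖ ^ 2 * Real.exp (-2 * ψ z / h) ≤
      (1 + a) * (2 / (Real.pi * h) * D) * b z +
      ∑ j, (1 + 1 / a) * (2 * r / Real.pi * Real.exp (2 * B * r ^ 2 / h)) * J j z := by
    intro z
    obtain ⟨α, β, hαβ⟩ := hle z
    have hbz : 0 < b z := hb₀.trans_le (hb z)
    refine (density_le hψc hψp hh hr hrpi hbz ha z α β hαβ
      (fun j => (hV _ (heV j)).1) (fun j => (hV _ (heV j)).2) horth).trans ?_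
    refine add_le_add ?_ ?_
    · rw [mul_assoc]
      refine mul_le_mul_of_nonneg_left ?_ (by positivity)
      have h1 : (1 - Real.exp (-(2 * b z / h) * r ^ 2))⁻¹ ≤ D := by
        refine inv_anti₀ (hexp hb₀) ?_
        have := hb z
        gcongr
      rw [mul_inv]
      calc _ ≤ (Real.pi / (2 * b z / h))⁻¹ * D := by gcongr
        _ = _ := by field_simp
    · rw [Finset.mul_sum]
      refine Finset.sum_le_sum fun j _ => ?_
      have hBz := hB z
      rw [mul_assoc (1 + 1 / a)]
      gcongr
      exact hJ0 j z
  have hleft : ∫ z in Efd, ∑ j, ‖e j z‖ ^ 2 * Real.exp (-2 * ψ z / h) = n := by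
    rw [integral_finsetSum]
    · have : ∀ j, ∫ z in Efd, ‖e j z‖ ^ 2 * Real.exp (-2 * ψ z / h) = 1 := hone
      rw [Finset.sum_congr rfl fun j _ => this j]
      simp
    · intro j _
      have := (hV _ (heV j)).1.continuous
      exact Continuous.integrableOn_Efd (by fun_prop)
  have hJint : ∀ j, ∫ z in Efd, J j z ≤ 2 * Real.pi * r * η := by
    intro j
    rw [hJ]
    rw [(hHp j).setIntegral_polar_integral (hHc j)]
    refine mul_le_mul_of_nonneg_left ?_ (by positivity)
    have := hη _ (heV j)
    rwa [hone, mul_one] at this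
  have hmono : ∫ z in Efd, ∑ j, ‖e j z‖ ^ 2 * Real.exp (-2 * ψ z / h) ≤
      ∫ z in Efd, ((1 + a) * (2 / (Real.pi * h) * D) * b z +
        ∑ j, (1 + 1 / a) * (2 * r / Real.pi * Real.exp (2 * B * r ^ 2 / h)) * J j z) := by
    refine setIntegral_mono ?_ ?_ hpt
    · refine Continuous.integrableOn_Efd (continuous_finsetSum _ fun j _ => ?_)
      have := (hV _ (heV j)).1.continuous
      fun_prop
    · exact Continuous.integrableOn_Efd ((hbc.const_mul _).add
        (continuous_finsetSum _ fun j _ => (hJc j).const_mul _))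
  rw [hleft, integral_add (hbc.const_mul _).integrableOn_Efd
    (continuous_finsetSum _ fun j _ => (hJc j).const_mul _).integrableOn_Efd,
    integral_finsetSum _ fun j _ => ((hJc j).const_mul _).integrableOn_Efd] at hmono
  simp_rw [integral_const_mul] at hmono
  refine hmono.trans (add_le_add (le_of_eq (by ring)) ?_)
  calc _ ≤ ∑ _j : Fin n, (1 + 1 / a) * (2 * r / Real.pi * Real.exp (2 * B * r ^ 2 / h)) *
        (2 * Real.pi * r * η) :=
        Finset.sum_le_sum fun j _ => mul_le_mul_of_nonneg_left (hJint j) (by positivity)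
    _ = _ := by
        rw [Finset.sum_const, Finset.card_univ, Fintype.card_fin, nsmul_eq_mul]
        field_simp
        ring

/-- The second derivative of `f` evaluated along fixed directions. -/
lemma fderiv_fderiv_apply_eq {f : ℂ → ℝ} (hf : ContDiff ℝ 2 f) (z v w : ℂ) :
    fderiv ℝ (fun x => fderiv ℝ f x v) z w = fderiv ℝ (fderiv ℝ f) z w v := by
  have hd : DifferentiableAt ℝ (fderiv ℝ f) z :=
    ((hf.fderiv_right (m := 1) (by norm_num)).differentiable (by norm_num)) z
  rw [fderiv_clm_apply hd (differentiableAt_const v)]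
  simp

lemma lapC_eq_fderiv_fderiv {f : ℂ → ℝ} (hf : ContDiff ℝ 2 f) (z : ℂ) :
    lapC f z = fderiv ℝ (fderiv ℝ f) z 1 1 + fderiv ℝ (fderiv ℝ f) z Complex.I Complex.I := by
  rw [lapC, fderiv_fderiv_apply_eq hf, fderiv_fderiv_apply_eq hf]

lemma continuous_lapC {f : ℂ → ℝ} (hf : ContDiff ℝ 2 f) : Continuous (lapC f) := by
  have h1 : Continuous (fderiv ℝ (fderiv ℝ f)) :=
    (hf.fderiv_right (m := 1) (by norm_num)).continuous_fderiv (by norm_num)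
  rw [funext (lapC_eq_fderiv_fderiv hf)]
  fun_prop

/-- Second order Taylor expansion with uniform remainder for a periodic function. -/
lemma taylor_two_of_periodicC {f : ℂ → ℝ} (hp : PeriodicC f) (hf : ContDiff ℝ 2 f) {ω : ℝ}
    (hω : 0 < ω) : ∃ r > 0, ∀ z w : ℂ, ‖w‖ ≤ r →
      |f (z + w) - f z - fderiv ℝ f z w - fderiv ℝ (fderiv ℝ f) z w w / 2| ≤ ω * ‖w‖ ^ 2 := by
  have h1 : ContDiff ℝ 1 (fderiv ℝ f) := hf.fderiv_right (by norm_num)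
  have hd1 : Differentiable ℝ (fderiv ℝ f) := h1.differentiable (by norm_num)
  have hd0 : Differentiable ℝ f := hf.differentiable (by norm_num)
  have h2 : Continuous (fderiv ℝ (fderiv ℝ f)) := h1.continuous_fderiv (by norm_num)
  obtain ⟨r, hr, hrD⟩ := Metric.uniformContinuous_iff.1
    (hp.fderiv.fderiv.uniformContinuous h2) ω hω
  refine ⟨r / 2, half_pos hr, fun z w hw => ?_⟩
  set A := fderiv ℝ (fderiv ℝ f) z with hA
  have hsymm : ∀ v v', A v v' = A v' v := fun v v' =>
    (hf.contDiffAt (x := z)).isSymmSndFDerivAt (by simp) v v'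
  have hfirst : ∀ v : ℂ, ‖v‖ ≤ ‖w‖ →
      ‖fderiv ℝ f (z + v) - fderiv ℝ f z - A v‖ ≤ ω * ‖w‖ := by
    intro v hv
    have hmv := (convex_closedBall z ‖w‖).norm_image_sub_le_of_norm_hasFDerivWithin_le'
      (f := fderiv ℝ f) (f' := fderiv ℝ (fderiv ℝ f)) (φ := A) (C := ω)
      (fun x _ => (hd1 x).hasFDerivAt.hasFDerivWithinAt) (fun x hx => by
        have hx' : dist x z < r := by
          have := Metric.mem_closedBall.1 hx
          linarith
        rw [← dist_eq_norm]
        exact (hrD hx').le)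
      (Metric.mem_closedBall_self (norm_nonneg w))
      (show z + v ∈ Metric.closedBall z ‖w‖ by simpa using hv)
    rw [add_sub_cancel_left] at hmv
    exact hmv.trans (by gcongr)
  set g : ℂ → ℝ := fun v => f (z + v) - A v v / 2 with hg
  have hgd : ∀ v, HasFDerivAt g (fderiv ℝ f (z + v) - A v) v := by
    intro v
    have e1 : HasFDerivAt (fun v => f (z + v)) (fderiv ℝ f (z + v)) v := by
      have := (hd0 (z + v)).hasFDerivAt
      exact (this.comp v ((hasFDerivAt_id v).const_add z)).congr_fderiv (by ext; simp)
    have e2 : HasFDerivAt (fun v => A v v / 2) (A v) v := by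
      have h3 := ((A.hasFDerivAt (x := v)).clm_apply (hasFDerivAt_id v)).mul_const ((2 : ℝ)⁻¹)
      refine (h3.congr_fderiv ?_).congr_of_eventuallyEq ?_
      · ext u; simp [hsymm _ v]; ring
      · exact Filter.Eventually.of_forall fun u => by simp [div_eq_mul_inv]
    exact e1.sub e2
  have hmv := (convex_closedBall (0 : ℂ) ‖w‖).norm_image_sub_le_of_norm_hasFDerivWithin_le'
      (f := g) (f' := fun v => fderiv ℝ f (z + v) - A v) (φ := fderiv ℝ f z) (C := ω * ‖w‖)
      (fun x _ => (hgd x).hasFDerivWithinAt) (fun x hx => by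
        rw [sub_right_comm]
        exact hfirst x (by simpa using hx))
      (Metric.mem_closedBall_self (norm_nonneg w))
      (show w ∈ Metric.closedBall 0 ‖w‖ by simp)
  simp only [hg, sub_zero, add_zero, map_zero, zero_div, Real.norm_eq_abs] at hmv
  calc _ = |f (z + w) - A w w / 2 - f z - fderiv ℝ f z w| := by congr 1; ring
    _ ≤ ω * ‖w‖ * ‖w‖ := hmv
    _ = _ := by ring

/-- Locally, a periodic `C²` function is bounded by the real part of a quadratic polynomial plus
a multiple of `‖w‖²` governed by its Laplacian. -/
lemma exists_local_weight_of_periodicC {f : ℂ → ℝ} (hp : PeriodicC f) (hf : ContDiff ℝ 2 f) {ω : ℝ}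
    (hω : 0 < ω) : ∃ r > 0, ∀ z : ℂ, ∃ α β : ℂ, ∀ w : ℂ, ‖w‖ ≤ r →
      f (z + w) ≤ f z + (α * w + β * w ^ 2).re + (lapC f z / 4 + ω) * ‖w‖ ^ 2 := by
  obtain ⟨r, hr, H⟩ := taylor_two_of_periodicC hp hf hω
  refine ⟨r, hr, fun z => ?_⟩
  set A := fderiv ℝ (fderiv ℝ f) z with hA
  set L := fderiv ℝ f z with hL
  refine ⟨⟨L 1, -L Complex.I⟩,
    ⟨(A 1 1 - A Complex.I Complex.I) / 4, -A 1 Complex.I / 2⟩, fun w hw => ?_⟩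
  have h1 := (abs_le.1 (H z w hw)).2
  have hsymm : A Complex.I 1 = A 1 Complex.I :=
    (hf.contDiffAt (x := z)).isSymmSndFDerivAt (by simp) Complex.I 1
  have hw' : w = w.re • (1 : ℂ) + w.im • Complex.I := by
    apply Complex.ext <;> simp
  have hLw : L w = w.re * L 1 + w.im * L Complex.I := by
    conv_lhs => rw [hw']
    simp only [map_add, map_smul, smul_eq_mul]
  have hAw : A w w = w.re ^ 2 * A 1 1 + 2 * (w.re * w.im) * A 1 Complex.I +
      w.im ^ 2 * A Complex.I Complex.I := by
    conv_lhs => rw [hw']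
    simp only [map_add, map_smul, smul_eq_mul, add_apply,
      smul_apply, hsymm]
    ring
  have hn : ‖w‖ ^ 2 = w.re ^ 2 + w.im ^ 2 := by
    rw [← Complex.normSq_eq_norm_sq, Complex.normSq_apply]; ring
  rw [lapC_eq_fderiv_fderiv hf, ← hA, hn]
  rw [← hA, ← hL, hLw, hAw, hn] at h1
  simp only [pow_two, Complex.add_re, Complex.mul_re, Complex.mul_im]
  nlinarith [h1]

/-- Asymptotic dimension bound for spaces of functions with exponentially small `∂̄`. -/
lemma exists_forall_finrank_le {ψ : ℂ → ℝ} (hp : PeriodicC ψ) (hψ : ContDiff ℝ 2 ψ) {κ ε : ℝ}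
    (hκ : 0 < κ) (hε : 0 < ε) : ∃ h₀ > 0, ∀ h : ℝ, 0 < h → h ≤ h₀ →
      ∀ (V : Submodule ℂ (ℂ → ℂ)) [FiniteDimensional ℂ V],
        (∀ u ∈ V, ContDiff ℝ 1 u ∧ PeriodicC u) →
        (∀ u ∈ V, wInt ψ h (dbar u) ≤ (h⁻¹ ^ 2 * Real.exp (-2 * κ / h)) * wInt ψ h u) →
        2 * Real.pi * h * (Module.finrank ℂ V : ℝ) ≤ (∫ z in Efd, max (lapC ψ z) 0) + ε := by
  have hpi := Real.pi_pos
  have hlc : Continuous (lapC ψ) := continuous_lapC hψ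
  set I := ∫ z in Efd, max (lapC ψ z) 0 with hI
  have hI0 : 0 ≤ I := integral_nonneg fun z => le_max_right _ _
  set ω := ε / (64 * Real.pi ^ 2) with hω
  have hω0 : 0 < ω := by positivity
  set a := ε / (4 * (I + ε)) with ha
  have ha0 : 0 < a := by positivity
  set b : ℂ → ℝ := fun z => max (lapC ψ z) 0 / 4 + ω with hb
  have hbc : Continuous b := by fun_prop
  have hbI : 4 * ∫ z in Efd, b z = I + ε / 4 := by
    rw [hb, integral_add (Continuous.integrableOn_Efd (by fun_prop))
      (Continuous.integrableOn_Efd (by fun_prop)), integral_div, setIntegral_const,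
      measureReal_Efd, smul_eq_mul, hω]
    field_simp
    ring
  obtain ⟨C, hC0, hC⟩ := hp.lapC.exists_norm_le hlc
  set B := C / 4 + ω with hB
  have hB0 : 0 < B := by positivity
  have hbB : ∀ z, b z ≤ B := fun z => by
    have := (le_abs_self _).trans (hC z)
    simp only [hb, hB]
    have : max (lapC ψ z) 0 ≤ C := max_le this hC0
    linarith
  obtain ⟨r₁, hr₁, hloc⟩ := exists_local_weight_of_periodicC hp hψ hω0
  set r := min (min r₁ Real.pi) (Real.sqrt (κ / (2 * B))) with hr
  have hr0 : 0 < r := by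
    have : 0 < κ / (2 * B) := by positivity
    simp only [hr, lt_min_iff, Real.sqrt_pos]
    exact ⟨⟨hr₁, hpi⟩, this⟩
  have hrr₁ : r ≤ r₁ := (min_le_left _ _).trans (min_le_left _ _)
  have hrpi : r ≤ Real.pi := (min_le_left _ _).trans (min_le_right _ _)
  have hrκ : 2 * B * r ^ 2 ≤ κ := by
    have h1 : r ^ 2 ≤ κ / (2 * B) := by
      rw [← Real.sq_sqrt (show 0 ≤ κ / (2 * B) by positivity)]
      have : r ≤ Real.sqrt (κ / (2 * B)) := min_le_right _ _
      gcongr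
    rwa [le_div_iff₀' (by positivity)] at h1
  have hle : ∀ z, ∃ α β : ℂ, ∀ w : ℂ, ‖w‖ ≤ r →
      ψ (z + w) ≤ ψ z + (α * w + β * w ^ 2).re + b z * ‖w‖ ^ 2 := by
    intro z
    obtain ⟨α, β, H⟩ := hloc z
    refine ⟨α, β, fun w hw => (H w (hw.trans hrr₁)).trans ?_⟩
    have : lapC ψ z ≤ max (lapC ψ z) 0 := le_max_left _ _
    simp only [hb]
    gcongr
  have htop : Filter.Tendsto (fun h : ℝ => h⁻¹) (nhdsWithin 0 (Set.Ioi 0)) Filter.atTop :=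
    tendsto_inv_nhdsGT_zero
  have hq : Filter.Tendsto (fun h : ℝ => 1 - (1 + 1 / a) * (4 * r ^ 2 *
      (h⁻¹ ^ (2 : ℝ) * Real.exp (-κ * h⁻¹)))) (nhdsWithin 0 (Set.Ioi 0)) (nhds 1) := by
    have h1 := (tendsto_rpow_mul_exp_neg_mul_atTop_nhds_zero 2 κ hκ).comp htop
    simpa using ((h1.const_mul (4 * r ^ 2)).const_mul (1 + 1 / a)).const_sub 1
  have hD : Filter.Tendsto (fun h : ℝ => (1 - Real.exp (-(2 * ω / h) * r ^ 2))⁻¹)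
      (nhdsWithin 0 (Set.Ioi 0)) (nhds 1) := by
    have h1 := (tendsto_rpow_mul_exp_neg_mul_atTop_nhds_zero 0 (2 * ω * r ^ 2)
      (by positivity)).comp htop
    have h2 := (h1.const_sub 1).inv₀ (by norm_num)
    simp only [sub_zero, inv_one] at h2
    refine h2.congr fun h => ?_
    simp only [Function.comp, Real.rpow_zero, one_mul]
    congr 3
    ring
  have hlim := ((hD.const_mul (1 + a)).mul_const (I + ε / 4)).mul (hq.inv₀ one_ne_zero)
  have hlt : (1 + a) * 1 * (I + ε / 4) * 1⁻¹ < I + ε := by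
    have : a * (I + ε) = ε / 4 := by
      rw [ha]; field_simp
    nlinarith
  obtain ⟨h₀, hh₀, H⟩ := (mem_nhdsGT_iff_exists_Ioc_subset).1
    ((hlim.eventually_lt_const hlt).and (hq.eventually_const_lt one_pos))
  refine ⟨h₀, hh₀, fun h hh hhle V _ hV hη => ?_⟩
  obtain ⟨H1, H2⟩ := H ⟨hh, hhle⟩
  have hmain := finrank_le_of_local_weight hψ.continuous hp hbc hh hr0 hrpi hω0
    (fun z => le_add_of_nonneg_left (by positivity)) hbB ha0 hle V hV hη
  set n : ℝ := (Module.finrank ℂ V : ℝ) with hn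
  have hn0 : 0 ≤ n := Nat.cast_nonneg _
  set D := (1 - Real.exp (-(2 * ω / h) * r ^ 2))⁻¹ with hDdef
  have hexp : Real.exp (2 * B * r ^ 2 / h) * (h⁻¹ ^ 2 * Real.exp (-2 * κ / h)) ≤
      h⁻¹ ^ (2 : ℝ) * Real.exp (-κ * h⁻¹) := by
    rw [Real.rpow_ofNat, mul_left_comm, ← Real.exp_add]
    gcongr
    rw [← add_div, div_le_iff₀ hh]
    field_simp
    linarith
  set Q := h⁻¹ ^ (2 : ℝ) * Real.exp (-κ * h⁻¹) with hQ
  refine le_of_lt (lt_of_le_of_lt ?_ H1)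
  rw [← div_eq_mul_inv, le_div_iff₀ H2]
  have hmain' : n ≤ (1 + a) * (2 / (Real.pi * h) * D * ∫ z in Efd, b z) +
      (1 + 1 / a) * (n * (4 * r ^ 2 * Q)) := by
    refine hmain.trans ?_
    rw [mul_assoc (4 * r ^ 2)]
    gcongr
  have h3 : (∫ z in Efd, b z) = (I + ε / 4) / 4 := by linarith
  rw [h3] at hmain'
  have h4 : 2 * Real.pi * h * (n - (1 + 1 / a) * (n * (4 * r ^ 2 * Q))) ≤
      2 * Real.pi * h * ((1 + a) * (2 / (Real.pi * h) * D * ((I + ε / 4) / 4))) := by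
    gcongr
    linarith
  calc _ = 2 * Real.pi * h * (n - (1 + 1 / a) * (n * (4 * r ^ 2 * Q))) := by ring
    _ ≤ _ := h4
    _ = _ := by field_simp; ring

/-- A smooth convex function vanishing on `(-∞, 2δ]` with slope `1` on `[4δ, ∞)`. -/
lemma exists_convex_cutoff {δ : ℝ} (hδ : 0 < δ) : ∃ β β' : ℝ → ℝ, ContDiff ℝ 1 β' ∧
    (∀ s, HasDerivAt β (β' s) s) ∧ Monotone β' ∧ (∀ s, 0 ≤ β' s) ∧ (∀ s, β' s ≤ 1) ∧
    (∀ s ≤ 2 * δ, β' s = 0) ∧ (∀ s, 4 * δ ≤ s → β' s = 1) ∧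
    (∀ s, 0 ≤ β s) ∧ (∀ s, β s ≤ max (s - 2 * δ) 0) := by
  set β' : ℝ → ℝ := fun s => Real.smoothTransition ((s - 2 * δ) / (2 * δ)) with hβ'
  have hC : ContDiff ℝ 1 β' :=
    (Real.smoothTransition.contDiff (n := 1)).comp ((contDiff_id.sub contDiff_const).div_const _)
  have h0 : ∀ s, 0 ≤ β' s := fun s => Real.smoothTransition.nonneg _
  have h1 : ∀ s, β' s ≤ 1 := fun s => Real.smoothTransition.le_one _
  have hz : ∀ s ≤ 2 * δ, β' s = 0 := fun s hs =>
    Real.smoothTransition.zero_of_nonpos (div_nonpos_of_nonpos_of_nonneg (by linarith)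
      (by linarith))
  have hzint : ∀ s ≤ 2 * δ, ∫ x in (2 * δ)..s, β' x = 0 := fun s hs => by
    rw [intervalIntegral.integral_symm, intervalIntegral.integral_congr (g := fun _ => (0 : ℝ)),
      intervalIntegral.integral_zero, neg_zero]
    intro x hx
    rw [Set.uIcc_of_le hs] at hx
    exact hz x hx.2
  refine ⟨fun s => ∫ x in (2 * δ)..s, β' x, β', hC, fun s => ?_, ?_, h0, h1, hz, ?_, ?_, ?_⟩
  · exact intervalIntegral.integral_hasDerivAt_right (hC.continuous.intervalIntegrable _ _)
      hC.continuous.stronglyMeasurable.stronglyMeasurableAtFilter hC.continuous.continuousAt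
  · exact Real.smoothTransition.monotone.comp fun x y hxy => by gcongr
  · intro s hs
    exact Real.smoothTransition.one_of_one_le (by rw [le_div_iff₀ (by positivity)]; linarith)
  · intro s
    rcases le_total s (2 * δ) with hs | hs
    · exact (hzint s hs).ge
    · exact intervalIntegral.integral_nonneg hs fun x _ => h0 x
  · intro s
    rcases le_total s (2 * δ) with hs | hs
    · exact (hzint s hs).le.trans (le_max_right _ _)
    · refine le_trans ?_ (le_max_left _ _)
      calc _ ≤ ∫ _x in (2 * δ)..s, (1 : ℝ) :=
            intervalIntegral.integral_mono_on hs (hC.continuous.intervalIntegrable _ _)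
              (by simp) fun x _ => h1 x
        _ = _ := by simp

/-- The Laplacian of `φ - β ∘ g`, when `β` is convex. -/
lemma lapC_sub_comp_le {φ g : ℂ → ℝ} {β β' : ℝ → ℝ} (hφ : ContDiff ℝ 2 φ) (hg : ContDiff ℝ 2 g)
    (hβ' : ContDiff ℝ 1 β') (hβ : ∀ s, HasDerivAt β (β' s) s) (hmono : Monotone β') (z : ℂ) :
    lapC (fun z => φ z - β (g z)) z ≤ lapC φ z - β' (g z) * lapC g z := by
  have hgd : Differentiable ℝ g := hg.differentiable (by norm_num)
  have hφd : Differentiable ℝ φ := hφ.differentiable (by norm_num)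
  have hfst : ∀ v, (fun w => fderiv ℝ (fun z => φ z - β (g z)) w v) =
      fun w => fderiv ℝ φ w v - β' (g w) * fderiv ℝ g w v := fun v => by
    funext w
    have h1 := (hφd w).hasFDerivAt.sub ((hβ (g w)).comp_hasFDerivAt w (hgd w).hasFDerivAt)
    have h2 := h1.fderiv
    simp only [Function.comp_def] at h2
    rw [show (fun z => φ z - β (g z)) = φ - fun z => β (g z) from rfl, h2]
    simp
  have hdir : ∀ {f : ℂ → ℝ}, ContDiff ℝ 2 f → ∀ v w,
      DifferentiableAt ℝ (fun w => fderiv ℝ f w v) w :=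
    fun hf v w => (((hf.fderiv_right (m := 1) (by norm_num)).clm_apply
      contDiff_const).differentiable (by norm_num)) w
  have hsnd : ∀ v, fderiv ℝ (fun w => fderiv ℝ (fun z => φ z - β (g z)) w v) z v ≤
      fderiv ℝ (fun w => fderiv ℝ φ w v) z v -
        β' (g z) * fderiv ℝ (fun w => fderiv ℝ g w v) z v := fun v => by
    have hb : HasFDerivAt (fun w => β' (g w)) (deriv β' (g z) • fderiv ℝ g z) z :=
      ((hβ'.differentiable (by norm_num)) (g z)).hasDerivAt.comp_hasFDerivAt z (hgd z).hasFDerivAt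
    have h1 := ((hdir hφ v z).hasFDerivAt.fun_sub (hb.fun_mul (hdir hg v z).hasFDerivAt)).fderiv
    rw [hfst, h1]
    have h2 : 0 ≤ deriv β' (g z) := hmono.deriv_nonneg
    have h3 : 0 ≤ deriv β' (g z) * (fderiv ℝ g z v) ^ 2 := by positivity
    simp only [sub_apply, add_apply, smul_apply, smul_eq_mul]
    nlinarith
  rw [lapC, lapC, lapC]
  linarith [hsnd 1, hsnd Complex.I]

lemma lapC_comp_const_sub (ρ : ℂ → ℝ) (z t : ℂ) :
    lapC (fun t => ρ (z - t)) t = lapC ρ (z - t) := by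
  have key : ∀ (g : ℂ → ℝ) (s v : ℂ),
      fderiv ℝ (fun t => g (z - t)) s v = -fderiv ℝ g (z - s) v := fun g s v => by
    have h1 : (fun t => g (z - t)) = fun t => (fun x => g (-x)) (t - z) := by
      funext t; simp
    rw [h1]
    refine (congrArg (· v) (fderiv_comp_sub (𝕜 := ℝ) (f := fun x => g (-x)) (x := s) z)).trans ?_
    have h2 := (ContinuousLinearEquiv.neg ℝ (M := ℂ)).comp_right_fderiv (f := g) (x := s - z)
    calc _ = _ := congrArg (· v) h2
      _ = _ := by simp
  simp only [lapC]
  simp_rw [key]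
  rw [fderiv_fun_neg, fderiv_fun_neg]
  have h2 := key (fun w => fderiv ℝ ρ w 1) t 1
  have h3 := key (fun w => fderiv ℝ ρ w Complex.I) t Complex.I
  simp only [neg_apply, h2, h3, neg_neg]

/-- Integration by parts for the Laplacian against a compactly supported function. -/
lemma integral_mul_lapC_eq {φ χ : ℂ → ℝ} (hφ : ContDiff ℝ 2 φ) (hχ : ContDiff ℝ 2 χ)
    (hc : HasCompactSupport χ) : ∫ z, φ z * lapC χ z = ∫ z, lapC φ z * χ z := by
  have hD : ∀ {f : ℂ → ℝ}, ContDiff ℝ 2 f → ∀ v, ContDiff ℝ 1 (fun w => fderiv ℝ f w v) :=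
    fun hf v => (hf.fderiv_right (m := 1) (by norm_num)).clm_apply contDiff_const
  have hDD : ∀ {f : ℂ → ℝ}, ContDiff ℝ 1 f → ∀ v, Continuous (fun w => fderiv ℝ f w v) :=
    fun hf v => (hf.continuous_fderiv (by norm_num)).clm_apply continuous_const
  have hcD : ∀ {f : ℂ → ℝ}, HasCompactSupport f → ∀ v,
      HasCompactSupport (fun w => fderiv ℝ f w v) :=
    fun hf v => hf.fderiv_apply ℝ v
  have hI : ∀ {f g : ℂ → ℝ}, Continuous f → Continuous g → HasCompactSupport g →
      Integrable (fun z => f z * g z) := fun hf hg hgc =>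
    (hf.mul hg).integrable_of_hasCompactSupport hgc.mul_left
  have hparts : ∀ {f g : ℂ → ℝ}, ContDiff ℝ 1 f → ContDiff ℝ 1 g → HasCompactSupport g → ∀ v,
      ∫ x, f x * fderiv ℝ g x v = -∫ x, fderiv ℝ f x v * g x := fun hf hg hgc v =>
    integral_mul_fderiv_eq_neg_fderiv_mul_of_integrable (hI (hDD hf v) hg.continuous hgc)
      (hI hf.continuous (hDD hg v) (hcD hgc v)) (hI hf.continuous hg.continuous hgc)
      (fun x _ => hf.differentiable (by norm_num) x) fun x _ => hg.differentiable (by norm_num) x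
  have htwice : ∀ v, ∫ z, φ z * fderiv ℝ (fun w => fderiv ℝ χ w v) z v =
      ∫ z, fderiv ℝ (fun w => fderiv ℝ φ w v) z v * χ z := fun v => by
    rw [hparts (hφ.of_le (by norm_num)) (hD hχ v) (hcD hc v),
      hparts (hD hφ v) (hχ.of_le (by norm_num)) hc, neg_neg]
  simp only [lapC, mul_add, add_mul]
  rw [integral_add (hI hφ.continuous (hDD (hD hχ 1) 1) (hcD (hcD hc 1) 1))
      (hI hφ.continuous (hDD (hD hχ _) _) (hcD (hcD hc _) _)),
    integral_add (hI (hDD (hD hφ 1) 1) hχ.continuous hc)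
      (hI (hDD (hD hφ _) _) hχ.continuous hc), htwice, htwice]

/-- The Laplacian of a mollified function. -/
lemma lapC_mollify {f ρ : ℂ → ℝ} (hf : Continuous f) (hρ : ContDiff ℝ 2 ρ)
    (hc : HasCompactSupport ρ) :
    ContDiff ℝ 2 (fun z => ∫ t, f t * ρ (z - t)) ∧
    ∀ z, lapC (fun z => ∫ t, f t * ρ (z - t)) z = ∫ t, f t * lapC (fun t => ρ (z - t)) t := by
  have hfl : LocallyIntegrable f volume := hf.locallyIntegrable
  have hone : ∀ {g : ℂ → ℝ}, ContDiff ℝ 1 g → HasCompactSupport g → ∀ z v,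
      fderiv ℝ (fun z => ∫ t, f t * g (z - t)) z v = ∫ t, f t * fderiv ℝ g (z - t) v := by
    intro g hg hgc z v
    have h1 := (hgc.hasFDerivAt_convolution_right (ContinuousLinearMap.mul ℝ ℝ)
      (μ := volume) hfl hg z).fderiv
    have h2 := convolution_precompR_apply (ContinuousLinearMap.mul ℝ ℝ) hfl (hgc.fderiv ℝ)
      (hg.continuous_fderiv (by norm_num)) z v
    rw [← h1] at h2
    exact h2
  have hD : ∀ v, ContDiff ℝ 1 (fun w => fderiv ℝ ρ w v) :=
    fun v => (hρ.fderiv_right (m := 1) (by norm_num)).clm_apply contDiff_const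
  have hcD : ∀ v, HasCompactSupport (fun w => fderiv ℝ ρ w v) := fun v => hc.fderiv_apply ℝ v
  have hI : ∀ {g : ℂ → ℝ}, Continuous g → HasCompactSupport g → ∀ z,
      Integrable (fun t => f t * g (z - t)) := fun hg hgc z =>
    (hgc.convolutionExists_right (ContinuousLinearMap.mul ℝ ℝ) hfl hg) z
  refine ⟨hc.contDiff_convolution_right (n := 2) (ContinuousLinearMap.mul ℝ ℝ) hfl hρ, fun z => ?_⟩
  simp_rw [lapC_comp_const_sub]
  simp only [lapC, mul_add]
  simp_rw [hone (hρ.of_le (by norm_num)) hc]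
  rw [integral_add
    (hI ((hD 1).continuous_fderiv (by norm_num) |>.clm_apply continuous_const)
      ((hcD 1).fderiv_apply ℝ 1) z)
    (hI ((hD Complex.I).continuous_fderiv (by norm_num) |>.clm_apply continuous_const)
      ((hcD Complex.I).fderiv_apply ℝ Complex.I) z),
    hone (hD 1) (hcD 1), hone (hD Complex.I) (hcD Complex.I)]

/-- A smooth approximate identity at scale `η`. -/
lemma exists_mollifier {η : ℝ} (hη : 0 < η) : ∃ ρ : ℂ → ℝ, ContDiff ℝ (⊤ : ℕ∞) ρ ∧
    HasCompactSupport ρ ∧ (∀ z, 0 ≤ ρ z) ∧ tsupport ρ ⊆ Metric.closedBall 0 η ∧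
    ∀ (g : ℂ → ℝ) (z : ℂ) (ε : ℝ), Continuous g → (∀ x, dist x z ≤ η → |g x - g z| ≤ ε) →
      |(∫ t, g t * ρ (z - t)) - g z| ≤ ε := by
  let Φ : ContDiffBump (0 : ℂ) := ⟨η / 2, η, half_pos hη, half_lt_self hη⟩
  refine ⟨Φ.normed volume, Φ.contDiff_normed, Φ.hasCompactSupport_normed, Φ.nonneg_normed,
    Φ.tsupport_normed_eq.subset, fun g z ε hg hε => ?_⟩
  have h1 := Φ.dist_normed_convolution_le (μ := volume) (x₀ := z) (ε := ε)
    hg.aestronglyMeasurable fun x hx => hε x (Metric.mem_ball.1 hx).le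
  rw [convolution_lsmul_swap, Real.dist_eq] at h1
  simpa only [smul_eq_mul, mul_comm] using h1

lemma PeriodicC.mollify {f : ℂ → ℝ} (hp : PeriodicC f) (ρ : ℂ → ℝ) :
    PeriodicC (fun z => ∫ t, f t * ρ (z - t)) := by
  have key : ∀ c : ℂ, (∀ z, f (z + c) = f z) → ∀ z,
      ∫ t, f t * ρ (z + c - t) = ∫ t, f t * ρ (z - t) := by
    intro c hc z
    rw [← integral_add_right_eq_self (fun t => f t * ρ (z + c - t)) c]
    simp_rw [hc, add_sub_add_right_eq_sub]
  exact fun z => ⟨key _ (fun z => (hp z).1) z, key _ (fun z => (hp z).2) z⟩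

/-- Regularization of a weight that is superharmonic off its contact set with `φ`. -/
lemma exists_regularized_weight {φ ψ : ℂ → ℝ} {τ δ ω : ℝ}
    (hφ : ContDiff ℝ (⊤ : ℕ∞) φ) (hφp : PeriodicC φ) (hψc : Continuous ψ) (hψp : PeriodicC ψ)
    (hlow : ∀ z, φ z - τ ≤ ψ z) (hsup : DSuphOn ψ {z | ψ z < φ z})
    (hδ : 0 < δ) (hδτ : 3 * δ / 2 ≤ τ) (hω : 0 < ω) :
    ∃ ψ₁ : ℂ → ℝ, ContDiff ℝ 2 ψ₁ ∧ PeriodicC ψ₁ ∧ (∀ z, φ z - τ + 3 * δ / 2 ≤ ψ₁ z) ∧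
      (∀ z, ψ₁ z ≤ φ z) ∧
      (∀ z, φ z - ψ z < 5 * δ → lapC ψ₁ z ≤ max (lapC φ z) 0 + ω) ∧
      ∀ z, 5 * δ ≤ φ z - ψ z → lapC ψ₁ z ≤ ω := by
  have hφ2 : ContDiff ℝ 2 φ := by exact_mod_cast contDiff_infty.1 hφ 2
  have hlapc : Continuous (lapC φ) := continuous_lapC hφ2
  set f : ℂ → ℝ := fun z => φ z - ψ z with hf
  have hfc : Continuous f := hφ.continuous.sub hψc
  have hfp : PeriodicC f := hφp.comp_two hψp (fun x y => x - y)
  obtain ⟨η₁, hη₁, H₁⟩ := Metric.uniformContinuous_iff.1 (hfp.uniformContinuous hfc) (δ / 2)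
    (half_pos hδ)
  obtain ⟨η₂, hη₂, H₂⟩ := Metric.uniformContinuous_iff.1 (hφp.lapC.uniformContinuous hlapc) ω hω
  set η := min η₁ η₂ / 2 with hη
  have hη0 : 0 < η := half_pos (lt_min hη₁ hη₂)
  have hηlt : η < min η₁ η₂ := half_lt_self (lt_min hη₁ hη₂)
  have hfη : ∀ x z, dist x z ≤ η → |f x - f z| ≤ δ / 2 := fun x z hx =>
    (H₁ (hx.trans_lt (hηlt.trans_le (min_le_left _ _)))).le
  have hlapη : ∀ x z, dist x z ≤ η → |lapC φ x - lapC φ z| ≤ ω := fun x z hx =>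
    (H₂ (hx.trans_lt (hηlt.trans_le (min_le_right _ _)))).le
  obtain ⟨ρ, hρ, hρc, hρ0, hρs, hρapprox⟩ := exists_mollifier hη0
  have hρ2 : ContDiff ℝ 2 ρ := by exact_mod_cast contDiff_infty.1 hρ 2
  obtain ⟨hgC, hglap⟩ := lapC_mollify hfc hρ2 hρc
  set g : ℂ → ℝ := fun z => ∫ t, f t * ρ (z - t) with hg
  have hgf : ∀ z, |g z - f z| ≤ δ / 2 := fun z =>
    hρapprox f z (δ / 2) hfc fun x hx => hfη x z hx
  obtain ⟨β, β', hβ'C, hβ, hmono, hβ'0, hβ'1, hβ'z, hβ'o, hβ0, hβle⟩ := exists_convex_cutoff hδ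
  have hβC : ContDiff ℝ 2 β := by
    have hd : deriv β = β' := funext fun s => (hβ s).deriv
    refine (contDiff_succ_iff_deriv (n := 1)).2 ⟨fun s => (hβ s).differentiableAt, by simp, ?_⟩
    rwa [hd]
  have hlap := lapC_sub_comp_le hφ2 hgC hβ'C hβ hmono
  have hsuper : ∀ z, 2 * δ < g z → lapC φ z - ω ≤ lapC g z := by
    intro z hz
    have hpos : ∀ t, dist t z ≤ η → ψ t < φ t := fun t ht => by
      have h1 := (abs_le.1 (hfη t z ht)).1
      have h2 := (abs_le.1 (hgf z)).2
      have h3 : 0 < f t := by linarith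
      simpa [hf] using h3
    have hχC : ContDiff ℝ (⊤ : ℕ∞) (fun t => ρ (z - t)) :=
      hρ.comp (contDiff_const.sub contDiff_id)
    have hχsub : tsupport (fun t => ρ (z - t)) ⊆ Metric.closedBall z η := by
      refine closure_minimal (fun t ht => ?_) Metric.isClosed_closedBall
      have := hρs (subset_tsupport ρ ht)
      rw [mem_closedBall_zero_iff] at this
      rwa [Metric.mem_closedBall, dist_comm, dist_eq_norm]
    have hχc : HasCompactSupport (fun t => ρ (z - t)) :=
      (isCompact_closedBall z η).of_isClosed_subset (isClosed_tsupport _) hχsub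
    have hs := hsup _ hχC hχc (fun t => hρ0 _) fun t ht => hpos t (hχsub ht)
    have hχ2 : ContDiff ℝ 2 (fun t => ρ (z - t)) := by exact_mod_cast contDiff_infty.1 hχC 2
    have hlapχ : Continuous (lapC fun t => ρ (z - t)) := continuous_lapC hχ2
    have hlapχc : HasCompactSupport (lapC fun t => ρ (z - t)) :=
      ((hχc.fderiv_apply ℝ 1).fderiv_apply ℝ 1).add
        ((hχc.fderiv_apply ℝ Complex.I).fderiv_apply ℝ Complex.I)
    have hI : ∀ {v : ℂ → ℝ}, Continuous v →
        Integrable (fun t => v t * lapC (fun t => ρ (z - t)) t) :=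
      fun hv => (hv.mul hlapχ).integrable_of_hasCompactSupport hlapχc.mul_left
    have h4 := hρapprox (lapC φ) z ω hlapc fun x hx => hlapη x z hx
    rw [← integral_mul_lapC_eq hφ2 hχ2 hχc] at h4
    rw [hglap]
    simp only [hf, sub_mul]
    rw [integral_sub (hI hφ.continuous) (hI hψc)]
    linarith [(abs_le.1 h4).1]
  refine ⟨fun z => φ z - β (g z), hφ2.sub (hβC.comp hgC),
    hφp.comp_two (hfp.mollify ρ) (fun x y => x - β y), fun z => ?_, fun z => ?_, fun z hz => ?_,
    fun z hz => ?_⟩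
  · have h1 := hβle (g z)
    have h2 := (abs_le.1 (hgf z)).2
    have h3 := hlow z
    have h4 : max (g z - 2 * δ) 0 ≤ τ - 3 * δ / 2 := by
      refine max_le ?_ (by linarith)
      have : f z = φ z - ψ z := rfl
      linarith
    linarith
  · linarith [hβ0 (g z)]
  · refine (hlap z).trans ?_
    have hm := le_max_left (lapC φ z) 0
    rcases le_or_gt (g z) (2 * δ) with hgz | hgz
    · rw [hβ'z _ hgz]
      linarith
    · have h1 := hsuper z hgz
      have hm' := le_max_right (lapC φ z) 0
      nlinarith [hβ'0 (g z), hβ'1 (g z), mul_le_mul_of_nonneg_left h1 (hβ'0 (g z)),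
        mul_nonneg (sub_nonneg.2 (hβ'1 (g z))) (sub_nonneg.2 hm), mul_nonneg (hβ'0 (g z)) hm',
        mul_nonneg (sub_nonneg.2 (hβ'1 (g z))) hω.le]
  · refine (hlap z).trans ?_
    have h2 := (abs_le.1 (hgf z)).1
    have h3 : 5 * δ ≤ f z := hz
    rw [hβ'o (g z) (by linarith)]
    linarith [hsuper z (by linarith)]

/-- A contact set is approximated by the sublevel sets of the gap. -/
lemma exists_setIntegral_sublevel_le {f k : ℂ → ℝ} (hf : Continuous f) (hk : Continuous k)
    (hf0 : ∀ z, 0 ≤ f z) {ε : ℝ} (hε : 0 < ε) :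
    ∃ c > 0, ∀ c' ≤ c, 0 < c' → ∫ z in {z | f z < c'} ∩ Efd, max (k z) 0 ≤
      (∫ z in {z | f z = 0} ∩ Efd, max (k z) 0) + ε := by
  set s : ℕ → Set ℂ := fun n => {z | f z < 1 / ((n : ℝ) + 1)} ∩ Efd with hs
  have hmeas : ∀ c, MeasurableSet ({z | f z < c} ∩ Efd) := fun c =>
    (isOpen_lt hf continuous_const).measurableSet.inter measurableSet_Efd
  have hint : IntegrableOn (fun z => max (k z) 0) Efd :=
    Continuous.integrableOn_Efd (by fun_prop)
  have hanti : Antitone s := fun m n hmn z hz =>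
    ⟨(show f z < 1 / ((n : ℝ) + 1) from hz.1).trans_le (Nat.one_div_le_one_div hmn), hz.2⟩
  have hlim := hanti.tendsto_setIntegral (μ := volume) (fun n => hmeas _)
    (hint.mono_set Set.inter_subset_right)
  have hInter : ⋂ n, s n = {z | f z = 0} ∩ Efd := by
    ext z
    simp only [hs, Set.mem_iInter, Set.mem_inter_iff, Set.mem_ofPred_eq]
    refine ⟨fun h => ⟨le_antisymm ?_ (hf0 z), (h 0).2⟩, fun h n => ⟨?_, h.2⟩⟩
    · exact ge_of_tendsto' tendsto_one_div_add_atTop_nhds_zero_nat fun n => (h n).1.le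
    · rw [h.1]; positivity
  rw [hInter] at hlim
  obtain ⟨n, hn⟩ := (hlim.eventually_lt_const (lt_add_of_pos_right _ hε)).exists
  refine ⟨1 / ((n : ℝ) + 1), by positivity, fun c' hc' _ => le_trans ?_ hn.le⟩
  refine setIntegral_mono_set (hint.mono_set Set.inter_subset_right) ?_ ?_
  · exact Filter.Eventually.of_forall fun z => le_max_right _ _
  · exact Filter.Eventually.of_forall fun z hz =>
      ⟨(show f z < c' from hz.1).trans_le hc', hz.2⟩

/-- Comparison of the weighted `∂̄`-estimates for two weights. -/
lemma wInt_dbar_le_of_weight_le {φ ψ₁ : ℂ → ℝ} {τ κ h : ℝ} (hφ : Continuous φ)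
    (hψ₁ : Continuous ψ₁) (hh : 0 < h) (hlow : ∀ z, φ z - τ + κ ≤ ψ₁ z)
    (hhigh : ∀ z, ψ₁ z ≤ φ z) {u : ℂ → ℂ} (hu : ContDiff ℝ 1 u)
    (hle : wInt φ h (fun z => (h : ℂ) * dbar u z) ≤ Real.exp (-τ / h) ^ 2 * wInt φ h u) :
    wInt ψ₁ h (dbar u) ≤ (h⁻¹ ^ 2 * Real.exp (-2 * κ / h)) * wInt ψ₁ h u := by
  have hdc := continuous_dbar hu
  have huc := hu.continuous
  have h1 : wInt ψ₁ h (dbar u) ≤ h⁻¹ ^ 2 * Real.exp (2 * (τ - κ) / h) *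
      wInt φ h (fun z => (h : ℂ) * dbar u z) := by
    simp only [wInt]
    rw [← integral_const_mul]
    refine setIntegral_mono (Continuous.integrableOn_Efd (by fun_prop))
      (Continuous.integrableOn_Efd (by fun_prop)) fun z => ?_
    have hexp : Real.exp (-2 * ψ₁ z / h) ≤
        Real.exp (2 * (τ - κ) / h) * Real.exp (-2 * φ z / h) := by
      rw [← Real.exp_add, ← add_div]
      have := hlow z
      gcongr
      linarith
    calc _ ≤ ‖dbar u z‖ ^ 2 * (Real.exp (2 * (τ - κ) / h) * Real.exp (-2 * φ z / h)) := by gcongr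
      _ = _ := by
        rw [norm_mul, Complex.norm_real, Real.norm_eq_abs, abs_of_pos hh]
        field_simp
  have h2 : wInt φ h u ≤ wInt ψ₁ h u := by
    simp only [wInt]
    refine setIntegral_mono (Continuous.integrableOn_Efd (by fun_prop))
      (Continuous.integrableOn_Efd (by fun_prop)) fun z => ?_
    have := hhigh z
    have hexp : Real.exp (-2 * φ z / h) ≤ Real.exp (-2 * ψ₁ z / h) := by
      rw [Real.exp_le_exp, div_le_div_iff_of_pos_right hh]
      linarith
    exact mul_le_mul_of_nonneg_left hexp (by positivity)
  calc _ ≤ _ := h1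
    _ ≤ h⁻¹ ^ 2 * Real.exp (2 * (τ - κ) / h) * (Real.exp (-τ / h) ^ 2 * wInt ψ₁ h u) := by
      gcongr
      exact hle.trans (by gcongr)
    _ = _ := by
      have : Real.exp (2 * (τ - κ) / h) * Real.exp (-τ / h) ^ 2 = Real.exp (-2 * κ / h) := by
        rw [← Real.exp_nat_mul, ← Real.exp_add]
        congr 1
        push_cast
        ring
      rw [← this]
      ring

/-- **Theorem (upper bound on the number of exponentially small singular values).** -/
theorem upper_bound_weight_counting
    (φ ψ : ℂ → ℝ) (τ : ℝ)
    (hφ : ContDiff ℝ (⊤ : ℕ∞) φ) (hφp : PeriodicC φ) (hφnc : ∃ z w : ℂ, φ z ≠ φ w)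
    (hτ0 : 0 < τ) (hτ : τ < sSup (φ '' Efd) - sInf (φ '' Efd))
    (hψc : Continuous ψ) (hψp : PeriodicC ψ)
    (hlow : ∀ z, φ z - τ ≤ ψ z) (hhigh : ∀ z, ψ z ≤ φ z)
    (hsup : DSuphOn ψ {z | ψ z < φ z})
    (hcontact : {z | ψ z = φ z} ⊆ {z | 0 < lapC φ z})
    (hint : (interior {z | ψ z = φ z}).Nonempty) :
    ∀ ε > 0, ∃ h₀ > 0, ∀ h : ℝ, 0 < h → h ≤ h₀ →
      2 * Real.pi * h * (countN φ (Real.exp (-τ / h)) h : ℝ) ≤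
        (∫ z in {z | ψ z = φ z} ∩ Efd, lapC φ z) + ε := by
  intro ε hε
  have hpi := Real.pi_pos
  have hφ2 : ContDiff ℝ 2 φ := by exact_mod_cast contDiff_infty.1 hφ 2
  have hlapc : Continuous (lapC φ) := continuous_lapC hφ2
  have hfc : Continuous (fun z => φ z - ψ z) := hφ.continuous.sub hψc
  have hK : {z | ψ z = φ z} = {z | φ z - ψ z = 0} := by
    ext z
    simp only [Set.mem_ofPred_eq, sub_eq_zero, eq_comm]
  have hKint : ∫ z in {z | ψ z = φ z} ∩ Efd, lapC φ z =
      ∫ z in {z | φ z - ψ z = 0} ∩ Efd, max (lapC φ z) 0 := by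
    rw [← hK]
    refine setIntegral_congr_fun
      ((isClosed_eq hψc hφ.continuous).measurableSet.inter measurableSet_Efd) fun z hz => ?_
    exact (max_eq_left (le_of_lt (hcontact hz.1))).symm
  have hK0 : 0 ≤ ∫ z in {z | φ z - ψ z = 0} ∩ Efd, max (lapC φ z) 0 :=
    integral_nonneg fun z => le_max_right _ _
  rw [hKint]
  obtain ⟨c, hc, hsub⟩ := exists_setIntegral_sublevel_le hfc hlapc
    (fun z => sub_nonneg.2 (hhigh z)) (show 0 < ε / 3 by positivity)
  set δ := min (c / 5) (τ / 2) with hδ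
  have hδ0 : 0 < δ := lt_min (by positivity) (by positivity)
  have hδc : 5 * δ ≤ c := by linarith [min_le_left (c / 5) (τ / 2)]
  have hδτ : 3 * δ / 2 ≤ τ := by linarith [min_le_right (c / 5) (τ / 2)]
  set ω := ε / (12 * Real.pi ^ 2) with hω
  have hω0 : 0 < ω := by positivity
  obtain ⟨ψ₁, hψ₁, hψ₁p, hψ₁low, hψ₁high, hlapnear, hlapfar⟩ :=
    exists_regularized_weight hφ hφp hψc hψp hlow hsup hδ0 hδτ hω0
  have hopen : MeasurableSet {z | φ z - ψ z < 5 * δ} :=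
    (isOpen_lt hfc continuous_const).measurableSet
  have hmaxint : IntegrableOn (fun z => max (lapC φ z) 0) Efd :=
    Continuous.integrableOn_Efd (by fun_prop)
  have hlap₁ : Continuous (lapC ψ₁) := continuous_lapC hψ₁
  have hI : ∫ z in Efd, max (lapC ψ₁ z) 0 ≤
      (∫ z in {z | φ z - ψ z = 0} ∩ Efd, max (lapC φ z) 0) + ε / 3 + ε / 3 := by
    calc ∫ z in Efd, max (lapC ψ₁ z) 0
        ≤ ∫ z in Efd, ({z | φ z - ψ z < 5 * δ}.indicator (fun z => max (lapC φ z) 0) z + ω) := by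
          refine setIntegral_mono (Continuous.integrableOn_Efd (by fun_prop))
            ((hmaxint.indicator hopen).add (integrable_const ω)) fun z => ?_
          by_cases hz : φ z - ψ z < 5 * δ
          · rw [Set.indicator_of_mem (by exact hz)]
            exact max_le (hlapnear z hz) (add_nonneg (le_max_right _ _) hω0.le)
          · rw [Set.indicator_of_notMem (by exact hz), zero_add]
            exact max_le (hlapfar z (not_lt.1 hz)) hω0.le
      _ = (∫ z in {z | φ z - ψ z < 5 * δ} ∩ Efd, max (lapC φ z) 0) + ε / 3 := by
          rw [integral_add (hmaxint.indicator hopen) (integrable_const ω),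
            integral_indicator hopen, Measure.restrict_restrict hopen, setIntegral_const,
            measureReal_Efd, smul_eq_mul, hω]
          congr 1
          field_simp
          norm_num
      _ ≤ _ := by
          gcongr
          exact hsub _ hδc (by positivity)
  obtain ⟨h₀, hh₀, H⟩ := exists_forall_finrank_le hψ₁p hψ₁
    (show 0 < 3 * δ / 2 by positivity) (show 0 < ε / 3 by positivity)
  refine ⟨h₀, hh₀, fun h hh hhle => ?_⟩
  set R := (∫ z in {z | φ z - ψ z = 0} ∩ Efd, max (lapC φ z) 0) + ε with hR
  have hR0 : 0 ≤ R / (2 * Real.pi * h) := by positivity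
  have hcount : countN φ (Real.exp (-τ / h)) h ≤ ⌊R / (2 * Real.pi * h)⌋₊ := by
    refine csSup_le' ?_
    rintro n ⟨V, rfl, hV, hVle⟩
    by_cases hfin : FiniteDimensional ℂ V
    · refine Nat.le_floor ?_
      rw [le_div_iff₀' (by positivity)]
      have hV1 : ∀ u ∈ V, ContDiff ℝ 1 u ∧ PeriodicC u := fun u hu =>
        ⟨by exact_mod_cast contDiff_infty.1 (hV u hu).1 1, (hV u hu).2⟩
      refine (H h hh hhle V hV1 fun u hu => ?_).trans (by linarith)
      exact wInt_dbar_le_of_weight_le hφ.continuous hψ₁.continuous hh hψ₁low hψ₁high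
        (hV1 u hu).1 (hVle u hu)
    · rw [Module.finrank_of_not_finite hfin]
      exact Nat.zero_le _
  have h1 : (countN φ (Real.exp (-τ / h)) h : ℝ) ≤ R / (2 * Real.pi * h) :=
    (Nat.cast_le.2 hcount).trans (Nat.floor_le hR0)
  rwa [le_div_iff₀' (by positivity)] at h1
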